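/- arXiv:1404.6497 — 5 statements merged into one kernel-verified Lean document; each statement's English description precedes it below -/
import Mathlib

section
/- Let k be a field, V a finite dimensional k-vector space, R ⊆ V⊗V a subspace, and α : R → V, β : R → k linear maps. Set P = {r − α(r) − β(r) : r ∈ R} ⊆ F²(T). Then the condition (J): (F¹(T)·P·F¹(T)) ∩ F²(T) = P holds if and only if the following three conditions hold: (i) (α⊗id − id⊗α)(W) ⊆ R; (ii) for all x ∈ W, α((α⊗id − id⊗α)(x)) = −(β⊗id − id⊗β)(x); and (iii) for all x ∈ W, β((α⊗id − id⊗α)(x)) = 0. Here W = (R⊗V) ∩ (V⊗R) ⊆ V⊗V⊗V, the map α⊗id − id⊗α : W → V⊗V is obtained by applying α⊗id to elements of W viewed in R⊗V and id⊗α to elements viewed in V⊗R, similarly β⊗id − id⊗β : W → V, and in (ii) and (iii) the element (α⊗id − id⊗α)(x) lies in R by (i), so α and β may be applied to it. -/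
open scoped TensorProduct

noncomputable section

variable (k : Type*) [Field k] (V : Type*) [AddCommGroup V] [Module k V]

/-- The multiplication map `V ⊗ V → T(V)`, `v ⊗ w ↦ ι(v)·ι(w)`, identifying `V ⊗ V` with the
degree-2 component `T²` of the tensor algebra. -/
def mul2 : V ⊗[k] V →ₗ[k] TensorAlgebra k V :=
  LinearMap.mul' k (TensorAlgebra k V) ∘ₗ
    TensorProduct.map (TensorAlgebra.ι k) (TensorAlgebra.ι k)

/-- The degree-one component `T¹ = V` of the tensor algebra. -/
def M12 : Submodule k (TensorAlgebra k V) :=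
  LinearMap.range (TensorAlgebra.ι k : V →ₗ[k] TensorAlgebra k V)

/-- The filtered component `F¹(T) = T⁰ ⊕ T¹`. -/
def F12_1 : Submodule k (TensorAlgebra k V) := 1 ⊔ M12 k V

/-- The filtered component `F²(T) = T⁰ ⊕ T¹ ⊕ T²`. -/
def F12_2 : Submodule k (TensorAlgebra k V) := 1 ⊔ M12 k V ⊔ M12 k V * M12 k V

variable (R : Submodule k (V ⊗[k] V)) (α : R →ₗ[k] V) (β : R →ₗ[k] k)

/-- The map `R → T(V)`, `r ↦ r − α(r) − β(r)`, whose range is the space of relations `P`. -/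
def Pmap : R →ₗ[k] TensorAlgebra k V :=
  mul2 k V ∘ₗ R.subtype - TensorAlgebra.ι k ∘ₗ α
    - Algebra.linearMap k (TensorAlgebra k V) ∘ₗ β

/-- The space of relations `P = {r − α(r) − β(r) : r ∈ R} ⊆ F²(T)`. -/
def Psub : Submodule k (TensorAlgebra k V) := LinearMap.range (Pmap k V R α β)

/-- The inclusion `R ⊗ V → V⊗V⊗V` (so that `W = (R⊗V) ∩ (V⊗R)` is the intersection of the
ranges of `j1` and `j2`). -/
def j1 : (↥R) ⊗[k] V →ₗ[k] (V ⊗[k] V) ⊗[k] V :=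
  TensorProduct.map R.subtype LinearMap.id

/-- The inclusion `V ⊗ R → V⊗V⊗V`. -/
def j2 : V ⊗[k] (↥R) →ₗ[k] (V ⊗[k] V) ⊗[k] V :=
  (TensorProduct.assoc k V V V).symm.toLinearMap ∘ₗ TensorProduct.map LinearMap.id R.subtype

/-- `α ⊗ id : R ⊗ V → V ⊗ V`. -/
def aid : (↥R) ⊗[k] V →ₗ[k] V ⊗[k] V := TensorProduct.map α LinearMap.id

/-- `id ⊗ α : V ⊗ R → V ⊗ V`. -/
def ida : V ⊗[k] (↥R) →ₗ[k] V ⊗[k] V := TensorProduct.map LinearMap.id α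

/-- `β ⊗ id : R ⊗ V → V`. -/
def bid : (↥R) ⊗[k] V →ₗ[k] V :=
  (TensorProduct.lid k V).toLinearMap ∘ₗ TensorProduct.map β LinearMap.id

/-- `id ⊗ β : V ⊗ R → V`. -/
def idb : V ⊗[k] (↥R) →ₗ[k] V :=
  (TensorProduct.rid k V).toLinearMap ∘ₗ TensorProduct.map LinearMap.id β

namespace TensorAlgebra

section

/-- The truncation `k ⊕ V ⊕ V^{⊗2} ⊕ V^{⊗3} ⊕ V^{⊗4}` of the tensor algebra of `V`, with
right-nested tensor powers. -/
abbrev Trunc :=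
  k × V × (V ⊗[k] V) × (V ⊗[k] (V ⊗[k] V)) × (V ⊗[k] (V ⊗[k] (V ⊗[k] V)))

/-- Left multiplication by vectors on the truncated tensor algebra. -/
def truncShift : V →ₗ[k] Module.End k (Trunc k V) :=
  LinearMap.mk₂ k
    (fun v n => (0, n.1 • v, v ⊗ₜ n.2.1, v ⊗ₜ n.2.2.1, v ⊗ₜ n.2.2.2.1))
    (fun _ _ _ => by simp [TensorProduct.add_tmul])
    (fun _ _ _ => by simp [TensorProduct.smul_tmul', smul_smul, mul_comm])
    (fun _ _ _ => by simp [TensorProduct.tmul_add, add_smul])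
    (fun _ _ _ => by simp [mul_smul])

/-- The projection of the tensor algebra onto its truncation in degrees at most `4`. -/
def trunc : TensorAlgebra k V →ₗ[k] Trunc k V :=
  LinearMap.applyₗ ((1, 0) : Trunc k V) ∘ₗ
    (TensorAlgebra.lift k (truncShift k V)).toLinearMap

variable {k V}

lemma trunc_ι_mul (v : V) (t : TensorAlgebra k V) :
    trunc k V (ι k v * t) = (0, (trunc k V t).1 • v, v ⊗ₜ (trunc k V t).2.1,
      v ⊗ₜ (trunc k V t).2.2.1, v ⊗ₜ (trunc k V t).2.2.2.1) := by
  simp [trunc, truncShift]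

lemma trunc_algebraMap (a : k) : trunc k V (algebraMap k _ a) = (a, 0) := by
  simp [trunc, Module.algebraMap_end_apply]

lemma trunc_ι (v : V) : trunc k V (ι k v) = (0, v, 0) := by
  have h := trunc_ι_mul v (1 : TensorAlgebra k V)
  rw [← map_one (algebraMap k (TensorAlgebra k V)), trunc_algebraMap] at h
  simpa [Prod.ext_iff] using h

end

end TensorAlgebra

section

open TensorAlgebra

variable {k V}

/-- The linear map `A ⊗ B → T`, `a ⊗ b ↦ f a * g b`. -/
def mulTensor {A B T : Type*} [AddCommGroup A] [Module k A] [AddCommGroup B] [Module k B]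
    [Ring T] [Algebra k T] (f : A →ₗ[k] T) (g : B →ₗ[k] T) : A ⊗[k] B →ₗ[k] T :=
  LinearMap.mul' k T ∘ₗ TensorProduct.map f g

@[simp]
lemma mulTensor_tmul {A B T : Type*} [AddCommGroup A] [Module k A] [AddCommGroup B] [Module k B]
    [Ring T] [Algebra k T] (f : A →ₗ[k] T) (g : B →ₗ[k] T) (a : A) (b : B) :
    mulTensor f g (a ⊗ₜ[k] b) = f a * g b := rfl

lemma range_mul_range_le {A B T : Type*} [AddCommGroup A] [Module k A] [AddCommGroup B]
    [Module k B] [Ring T] [Algebra k T] (f : A →ₗ[k] T) (g : B →ₗ[k] T) :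
    LinearMap.range f * LinearMap.range g ≤ LinearMap.range (mulTensor f g) := by
  rw [Submodule.mul_le]
  rintro _ ⟨a, rfl⟩ _ ⟨b, rfl⟩
  exact ⟨a ⊗ₜ b, rfl⟩

lemma mulTensor_mem_range_mul_range {A B T : Type*} [AddCommGroup A] [Module k A]
    [AddCommGroup B] [Module k B] [Ring T] [Algebra k T] (f : A →ₗ[k] T) (g : B →ₗ[k] T)
    (x : A ⊗[k] B) : mulTensor f g x ∈ LinearMap.range f * LinearMap.range g := by
  induction x with
  | zero => simp
  | tmul a b => exact Submodule.mul_mem_mul ⟨a, rfl⟩ ⟨b, rfl⟩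
  | add x y hx hy => rw [map_add]; exact add_mem hx hy

@[simp]
lemma mul2_tmul (v w : V) : mul2 k V (v ⊗ₜ w) = ι k v * ι k w := rfl

variable {R : Submodule k (V ⊗[k] V)} {α : R →ₗ[k] V} {β : R →ₗ[k] k}

lemma Pmap_apply (r : R) :
    Pmap k V R α β r = mul2 k V r - ι k (α r) - algebraMap k _ (β r) := rfl

lemma trunc_mul2 (x : V ⊗[k] V) : trunc k V (mul2 k V x) = (0, 0, x, 0) := by
  induction x with
  | zero => simp [Prod.ext_iff]
  | tmul v w => simp [trunc_ι_mul, trunc_ι]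
  | add x y hx hy => simp [hx, hy]

lemma trunc_mul2_mul_ι (x : V ⊗[k] V) (v : V) :
    trunc k V (mul2 k V x * ι k v) = (0, 0, 0, TensorProduct.assoc k V V V (x ⊗ₜ v), 0) := by
  induction x with
  | zero => simp [Prod.ext_iff]
  | tmul v w => simp [mul_assoc, trunc_ι_mul, trunc_ι]
  | add x y hx hy => simp [hx, hy, add_mul, TensorProduct.add_tmul]

lemma trunc_mulTensor_mul2_ι (x : (V ⊗[k] V) ⊗[k] V) :
    trunc k V (mulTensor (mul2 k V) (ι k) x) = (0, 0, 0, TensorProduct.assoc k V V V x, 0) := by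
  induction x with
  | zero => simp [Prod.ext_iff]
  | tmul x v => exact trunc_mul2_mul_ι x v
  | add x y hx hy => simp [hx, hy]

lemma trunc_Pmap (r : R) : trunc k V (Pmap k V R α β r) = (-β r, -α r, (r : V ⊗[k] V), 0) := by
  simp [Pmap_apply, trunc_mul2, trunc_ι, trunc_algebraMap]

lemma mulTensor_Pmap_ι (y : R ⊗[k] V) :
    mulTensor (Pmap k V R α β) (ι k) y = mulTensor (mul2 k V) (ι k) (j1 k V R y)
      - mul2 k V (aid k V R α y) - ι k (bid k V R β y) := by
  induction y with
  | zero => simp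
  | tmul r v => simp [Pmap_apply, j1, aid, bid, sub_mul, Algebra.smul_def]
  | add x y hx hy => simp only [map_add, hx, hy]; abel

lemma mulTensor_ι_mul2 (z : V ⊗[k] (V ⊗[k] V)) :
    mulTensor (ι k) (mul2 k V) z =
      mulTensor (mul2 k V) (ι k) ((TensorProduct.assoc k V V V).symm z) := by
  induction z with
  | zero => simp
  | tmul v x =>
    induction x with
    | zero => simp
    | tmul u w => simp [mul_assoc]
    | add x y hx hy => simp only [TensorProduct.tmul_add, map_add, hx, hy]
  | add x y hx hy => simp only [map_add, hx, hy]

lemma mulTensor_ι_Pmap (z : V ⊗[k] R) :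
    mulTensor (ι k) (Pmap k V R α β) z = mulTensor (mul2 k V) (ι k) (j2 k V R z)
      - mul2 k V (ida k V R α z) - ι k (idb k V R β z) := by
  induction z with
  | zero => simp
  | tmul v r =>
    have h := mulTensor_ι_mul2 (k := k) (v ⊗ₜ (r : V ⊗[k] V))
    rw [mulTensor_tmul] at h
    simp [Pmap_apply, j2, ida, idb, mul_sub, ← h, Algebra.smul_def,
      Algebra.commutes]
  | add x y hx hy => simp only [map_add, hx, hy]; abel

lemma trunc_mulTensor_Pmap_ι (y : R ⊗[k] V) :
    trunc k V (mulTensor (Pmap k V R α β) (ι k) y) =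
      (0, -bid k V R β y, -aid k V R α y, TensorProduct.assoc k V V V (j1 k V R y), 0) := by
  simp [mulTensor_Pmap_ι, trunc_mulTensor_mul2_ι, trunc_mul2, trunc_ι]

lemma trunc_mulTensor_ι_Pmap (z : V ⊗[k] R) :
    trunc k V (mulTensor (ι k) (Pmap k V R α β) z) =
      (0, -idb k V R β z, -ida k V R α z, TensorProduct.assoc k V V V (j2 k V R z), 0) := by
  simp [mulTensor_ι_Pmap, trunc_mulTensor_mul2_ι, trunc_mul2, trunc_ι]

lemma j1_injective : Function.Injective (j1 k V R) :=
  Module.Flat.rTensor_preserves_injective_linearMap R.subtype R.injective_subtype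

lemma trunc_mulTensor_ι_mulTensor_Pmap_ι (t : V ⊗[k] (R ⊗[k] V)) :
    (trunc k V (mulTensor (ι k) (mulTensor (Pmap k V R α β) (ι k)) t)).2.2.2.2 =
      LinearMap.lTensor V ((TensorProduct.assoc k V V V).toLinearMap ∘ₗ j1 k V R) t := by
  induction t with
  | zero => simp
  | tmul v y => simp [trunc_ι_mul, trunc_mulTensor_Pmap_ι]
  | add x y hx hy => simp only [map_add, Prod.snd_add, hx, hy]

lemma eq_zero_of_trunc_mulTensor_eq_zero {t : V ⊗[k] (R ⊗[k] V)}
    (h : (trunc k V (mulTensor (ι k) (mulTensor (Pmap k V R α β) (ι k)) t)).2.2.2.2 = 0) :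
    t = 0 := by
  rw [trunc_mulTensor_ι_mulTensor_Pmap_ι] at h
  refine Module.Flat.lTensor_preserves_injective_linearMap (M := V)
    ((TensorProduct.assoc k V V V).toLinearMap ∘ₗ j1 k V R)
    ((TensorProduct.assoc k V V V).injective.comp j1_injective) ?_
  rw [h, map_zero]

lemma trunc_of_mem_F12_2 {x : TensorAlgebra k V} (hx : x ∈ F12_2 k V) :
    (trunc k V x).2.2.2 = 0 := by
  have hle : F12_2 k V ≤ LinearMap.ker (LinearMap.snd k _ _ ∘ₗ LinearMap.snd k _ _ ∘ₗ
      LinearMap.snd k _ _ ∘ₗ trunc k V) := by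
    refine sup_le (sup_le ?_ ?_) ((range_mul_range_le _ _).trans ?_)
    · rw [Submodule.one_le]
      simpa using congrArg (fun n => n.2.2.2) (trunc_algebraMap (V := V) (1 : k))
    · rintro _ ⟨v, rfl⟩
      simp [trunc_ι]
    · rintro _ ⟨x, rfl⟩
      exact congrArg (fun n => n.2.2.2) (trunc_mul2 x)
  exact hle hx

lemma algebraMap_mem_F12_2 (a : k) : algebraMap k (TensorAlgebra k V) a ∈ F12_2 k V :=
  Submodule.mem_sup_left (Submodule.mem_sup_left (Submodule.algebraMap_mem a))

lemma ι_mem_F12_2 (v : V) : ι k v ∈ F12_2 k V :=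
  Submodule.mem_sup_left (Submodule.mem_sup_right ⟨v, rfl⟩)

lemma mul2_mem_F12_2 (x : V ⊗[k] V) : mul2 k V x ∈ F12_2 k V :=
  Submodule.mem_sup_right (mulTensor_mem_range_mul_range _ _ x)

lemma Psub_le_F12_2 : Psub k V R α β ≤ F12_2 k V := by
  rintro _ ⟨r, rfl⟩
  rw [Pmap_apply]
  exact sub_mem (sub_mem (mul2_mem_F12_2 _) (ι_mem_F12_2 _)) (algebraMap_mem_F12_2 _)

lemma F12_1_mul_Psub_mul_F12_1_eq :
    F12_1 k V * Psub k V R α β * F12_1 k V =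
      Psub k V R α β ⊔ M12 k V * Psub k V R α β ⊔ Psub k V R α β * M12 k V ⊔
        M12 k V * (Psub k V R α β * M12 k V) := by
  rw [F12_1, Submodule.sup_mul, one_mul, Submodule.mul_sup, mul_one, Submodule.sup_mul, mul_assoc,
    ← sup_assoc]

lemma exists_eq_of_mem_F12_1_mul_Psub_mul_F12_1 {x : TensorAlgebra k V}
    (hx : x ∈ F12_1 k V * Psub k V R α β * F12_1 k V) :
    ∃ (r : R) (z : V ⊗[k] R) (y : R ⊗[k] V) (t : V ⊗[k] (R ⊗[k] V)),
      Pmap k V R α β r + mulTensor (ι k) (Pmap k V R α β) z +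
        mulTensor (Pmap k V R α β) (ι k) y +
        mulTensor (ι k) (mulTensor (Pmap k V R α β) (ι k)) t = x := by
  rw [F12_1_mul_Psub_mul_F12_1_eq] at hx
  obtain ⟨_, h₁, _, ht, rfl⟩ := Submodule.mem_sup.1 hx
  obtain ⟨_, h₂, _, hy, rfl⟩ := Submodule.mem_sup.1 h₁
  obtain ⟨_, ⟨r, rfl⟩, _, hz, rfl⟩ := Submodule.mem_sup.1 h₂
  obtain ⟨z, rfl⟩ := range_mul_range_le _ _ hz
  obtain ⟨y, rfl⟩ := range_mul_range_le _ _ hy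
  obtain ⟨t, rfl⟩ := range_mul_range_le _ _
    (mul_le_mul_right (range_mul_range_le _ _) _ ht)
  exact ⟨r, z, y, t, rfl⟩

lemma mulTensor_sub_mulTensor {y : R ⊗[k] V} {z : V ⊗[k] R} (h : j1 k V R y = j2 k V R z) :
    mulTensor (Pmap k V R α β) (ι k) y - mulTensor (ι k) (Pmap k V R α β) z =
      -mul2 k V (aid k V R α y - ida k V R α z) - ι k (bid k V R β y - idb k V R β z) := by
  rw [mulTensor_Pmap_ι, mulTensor_ι_Pmap, h, map_sub, map_sub]
  abel

lemma mulTensor_sub_mulTensor_mem {y : R ⊗[k] V} {z : V ⊗[k] R} :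
    mulTensor (Pmap k V R α β) (ι k) y - mulTensor (ι k) (Pmap k V R α β) z ∈
      F12_1 k V * Psub k V R α β * F12_1 k V := by
  rw [F12_1_mul_Psub_mul_F12_1_eq]
  refine sub_mem (Submodule.mem_sup_left (Submodule.mem_sup_right ?_))
    (Submodule.mem_sup_left (Submodule.mem_sup_left (Submodule.mem_sup_right ?_)))
  · exact mulTensor_mem_range_mul_range _ _ y
  · exact mulTensor_mem_range_mul_range _ _ z

lemma exists_of_inf_eq
    (hJ : F12_1 k V * Psub k V R α β * F12_1 k V ⊓ F12_2 k V = Psub k V R α β)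
    {y : R ⊗[k] V} {z : V ⊗[k] R} (h : j1 k V R y = j2 k V R z) :
    ∃ r : R, r = aid k V R α y - ida k V R α z ∧
      α r = -(bid k V R β y - idb k V R β z) ∧ β r = 0 := by
  have hmem : mulTensor (Pmap k V R α β) (ι k) y - mulTensor (ι k) (Pmap k V R α β) z ∈
      Psub k V R α β := by
    rw [← hJ]
    refine ⟨mulTensor_sub_mulTensor_mem, ?_⟩
    rw [mulTensor_sub_mulTensor h]
    exact sub_mem (neg_mem (mul2_mem_F12_2 _)) (ι_mem_F12_2 _)
  obtain ⟨r, hr⟩ := hmem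
  have ht := congrArg (trunc k V) hr
  rw [mulTensor_sub_mulTensor h, trunc_Pmap, map_sub, map_neg, trunc_mul2, trunc_ι] at ht
  simp only [Prod.ext_iff, Prod.fst_sub, Prod.snd_sub, Prod.fst_neg, Prod.snd_neg, neg_zero,
    sub_zero, zero_sub] at ht
  obtain ⟨h0, h1, h2, -⟩ := ht
  refine ⟨-r, ?_, ?_, ?_⟩
  · rw [NegMemClass.coe_neg, h2]
    simp
  · rw [map_neg, h1]
  · rw [map_neg, h0]

lemma inf_le_Psub
    (H : ∀ (y : R ⊗[k] V) (z : V ⊗[k] R), j1 k V R y = j2 k V R z →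
      ∃ r : R, r = aid k V R α y - ida k V R α z ∧
        α r = -(bid k V R β y - idb k V R β z) ∧ β r = 0) :
    F12_1 k V * Psub k V R α β * F12_1 k V ⊓ F12_2 k V ≤ Psub k V R α β := by
  rintro x ⟨hx, hx2⟩
  obtain ⟨r, z, y, t, rfl⟩ := exists_eq_of_mem_F12_1_mul_Psub_mul_F12_1 hx
  replace hx2 := trunc_of_mem_F12_2 hx2
  obtain rfl : t = 0 := by
    refine eq_zero_of_trunc_mulTensor_eq_zero (α := α) (β := β) ?_
    simpa [trunc_Pmap, trunc_mulTensor_Pmap_ι, trunc_mulTensor_ι_Pmap] using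
      congrArg Prod.snd hx2
  have hyz : j1 k V R y = j2 k V R (-z) := by
    have h3 := congrArg Prod.fst hx2
    simp only [map_add, map_zero, trunc_Pmap, trunc_mulTensor_Pmap_ι, trunc_mulTensor_ι_Pmap,
      Prod.snd_add, Prod.fst_add, Prod.fst_zero, zero_add, add_zero] at h3
    rw [← map_add, LinearEquiv.map_eq_zero_iff] at h3
    rw [map_neg]
    exact eq_neg_of_add_eq_zero_right h3
  obtain ⟨s, hs, hαs, hβs⟩ := H y (-z) hyz
  refine ⟨r - s, ?_⟩
  have h := mulTensor_sub_mulTensor (α := α) (β := β) hyz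
  rw [← hs, ← neg_eq_iff_eq_neg.2 hαs, map_neg (mulTensor _ _), sub_neg_eq_add] at h
  rw [map_zero, add_zero, add_assoc, add_comm (mulTensor _ _ z), h, map_sub, Pmap_apply s, hβs]
  simp
  abel

end

/-- **Braverman–Gaitsgory condition (J) unravelled.** For `P = {r − α(r) − β(r) : r ∈ R}`,
condition (J): `(F¹(T)·P·F¹(T)) ∩ F²(T) = P` holds if and only if, on
`W = (R⊗V) ∩ (V⊗R)` (described via pairs of representatives `y ∈ R⊗V`, `z ∈ V⊗R` with the
same image in `V⊗V⊗V`):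
(i) `(α⊗id − id⊗α)(W) ⊆ R`;
(ii) `α ∘ (α⊗id − id⊗α) = −(β⊗id − id⊗β)` on `W`; and
(iii) `β ∘ (α⊗id − id⊗α) = 0` on `W`. -/
theorem stmt12 [FiniteDimensional k V] :
    F12_1 k V * Psub k V R α β * F12_1 k V ⊓ F12_2 k V = Psub k V R α β ↔
      ((∀ (y : (↥R) ⊗[k] V) (z : V ⊗[k] (↥R)), j1 k V R y = j2 k V R z →
          aid k V R α y - ida k V R α z ∈ R) ∧
        (∀ (y : (↥R) ⊗[k] V) (z : V ⊗[k] (↥R)) (_ : j1 k V R y = j2 k V R z)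
            (hm : aid k V R α y - ida k V R α z ∈ R),
          α ⟨aid k V R α y - ida k V R α z, hm⟩ = -(bid k V R β y - idb k V R β z)) ∧
        (∀ (y : (↥R) ⊗[k] V) (z : V ⊗[k] (↥R)) (_ : j1 k V R y = j2 k V R z)
            (hm : aid k V R α y - ida k V R α z ∈ R),
          β ⟨aid k V R α y - ida k V R α z, hm⟩ = 0)) := by
  constructor
  · intro hJ
    refine ⟨fun y z h => ?_, fun y z h hm => ?_, fun y z h hm => ?_⟩ <;>
      obtain ⟨r, hr, hα, hβ⟩ := exists_of_inf_eq hJ h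
    · exact hr ▸ r.2
    · rwa [show (⟨_, hm⟩ : R) = r from Subtype.ext hr.symm]
    · rwa [show (⟨_, hm⟩ : R) = r from Subtype.ext hr.symm]
  · rintro ⟨h1, h2, h3⟩
    refine le_antisymm (inf_le_Psub fun y z h =>
      ⟨⟨_, h1 y z h⟩, rfl, h2 y z h _, h3 y z h _⟩) (le_inf ?_ Psub_le_F12_2)
    rw [F12_1_mul_Psub_mul_F12_1_eq, sup_assoc, sup_assoc]
    exact le_sup_left
end
end

section
/- Let k be a field of characteristic not 2, V a finite dimensional k-vector space, and b : V × V → V a bilinear map. Let P ⊆ F²(T) be the k-linear span of the elements v⊗w − w⊗v − b(v,w) for v, w ∈ V. Then P ∩ F¹(T) = 0 if and only if b is antisymmetric, i.e., b(w,v) = −b(v,w) for all v, w ∈ V. -/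
/-- The degree-one component `T¹ = V` of the tensor algebra, i.e. the range of
`ι : V → T(V)`. -/
noncomputable def TM (k : Type*) [Field k] (V : Type*) [AddCommGroup V] [Module k V] :
    Submodule k (TensorAlgebra k V) :=
  LinearMap.range (TensorAlgebra.ι k : V →ₗ[k] TensorAlgebra k V)

/-- The first filtered component `F¹(T) = T⁰ ⊕ T¹` of the tensor algebra. -/
noncomputable def TF1 (k : Type*) [Field k] (V : Type*) [AddCommGroup V] [Module k V] :
    Submodule k (TensorAlgebra k V) :=
  1 ⊔ TM k V

/-- The span `P` of the elements `v⊗w − w⊗v − b(v,w)` inside `F²(T)`. -/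
noncomputable def Pspan13 (k : Type*) [Field k] (V : Type*) [AddCommGroup V] [Module k V]
    (b : V →ₗ[k] V →ₗ[k] V) : Submodule k (TensorAlgebra k V) :=
  Submodule.span k {x | ∃ v w : V,
    x = TensorAlgebra.ι k v * TensorAlgebra.ι k w
      - TensorAlgebra.ι k w * TensorAlgebra.ι k v - TensorAlgebra.ι k (b v w)}

/-- The algebra map `T(V) → End(k × V)` through which `v` acts by
`(c, u) ↦ (0, c • v + B v u)`. -/
noncomputable def bilinAction (k : Type*) [Field k] (V : Type*) [AddCommGroup V] [Module k V]
    (B : V →ₗ[k] V →ₗ[k] V) : TensorAlgebra k V →ₐ[k] Module.End k (k × V) :=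
  TensorAlgebra.lift k
    (LinearMap.mk₂ k (fun v (p : k × V) => ((0 : k), p.1 • v + B v p.2))
      (fun v v' p => by ext <;> simp; abel)
      (fun c v p => by ext <;> simp [smul_comm c p.1 v])
      (fun v p q => by ext <;> simp [add_smul]; abel)
      (fun c v p => by ext <;> simp [mul_smul]))

theorem bilinAction_ι (k : Type*) [Field k] (V : Type*) [AddCommGroup V] [Module k V]
    (B : V →ₗ[k] V →ₗ[k] V) (v : V) (p : k × V) :
    bilinAction k V B (TensorAlgebra.ι k v) p = (0, p.1 • v + B v p.2) := by
  simp [bilinAction]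

/-- If `b` is the antisymmetrization of `B`, then `P` annihilates `(1, 0)`. -/
theorem bilinAction_eq_zero_of_mem (k : Type*) [Field k] (V : Type*) [AddCommGroup V] [Module k V]
    (b B : V →ₗ[k] V →ₗ[k] V) (hB : ∀ v w, B v w - B w v = b v w)
    {x : TensorAlgebra k V} (hx : x ∈ Pspan13 k V b) :
    bilinAction k V B x (1, 0) = 0 := by
  suffices h : Pspan13 k V b ≤ LinearMap.ker
      (LinearMap.applyₗ ((1, 0) : k × V) ∘ₗ (bilinAction k V B).toLinearMap) from h hx
  refine Submodule.span_le.2 ?_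
  rintro _ ⟨v, w, rfl⟩
  simp [bilinAction_ι, hB]

/-- **Condition (I) and antisymmetry.** Over a field of characteristic not 2, for a bilinear
map `b : V × V → V` and `P` the span of the elements `v⊗w − w⊗v − b(v,w)`, one has
`P ∩ F¹(T) = 0` if and only if `b` is antisymmetric. -/
theorem stmt13 (k : Type*) [Field k] (hchar : ringChar k ≠ 2)
    (V : Type*) [AddCommGroup V] [Module k V] [FiniteDimensional k V]
    (b : V →ₗ[k] V →ₗ[k] V) :
    Pspan13 k V b ⊓ TF1 k V = ⊥ ↔ ∀ v w : V, b w v = - b v w := by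
  constructor
  · intro h v w
    have mem : TensorAlgebra.ι k (b w v + b v w) ∈ Pspan13 k V b ⊓ TF1 k V := by
      refine ⟨?_, Submodule.mem_sup_right ⟨_, rfl⟩⟩
      have hsum := (Pspan13 k V b).neg_mem ((Pspan13 k V b).add_mem
        (Submodule.subset_span ⟨v, w, rfl⟩) (Submodule.subset_span ⟨w, v, rfl⟩))
      rw [map_add]
      refine (congrArg (· ∈ Pspan13 k V b) ?_).mpr hsum
      abel
    rw [h, Submodule.mem_bot, TensorAlgebra.ι_eq_zero_iff] at mem
    exact eq_neg_of_add_eq_zero_left mem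
  · intro h
    have two_ne : (2 : k) ≠ 0 := Ring.two_ne_zero hchar
    have half : ∀ v w, ((2 : k)⁻¹ • b) v w - ((2 : k)⁻¹ • b) w v = b v w := by
      intro v w
      simp only [LinearMap.smul_apply, h v w]
      rw [smul_neg, sub_neg_eq_add, ← add_smul, ← two_mul, mul_inv_cancel₀ two_ne, one_smul]
    refine (Submodule.eq_bot_iff _).2 ?_
    rintro x ⟨hP, hF⟩
    have hx := bilinAction_eq_zero_of_mem k V b _ half hP
    obtain ⟨y, hy, z, ⟨v, rfl⟩, rfl⟩ := Submodule.mem_sup.1 hF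
    obtain ⟨r, rfl⟩ := Submodule.mem_one.1 hy
    rw [map_add, AlgHom.commutes, LinearMap.add_apply, bilinAction_ι] at hx
    simp only [Module.algebraMap_end_apply, Prod.smul_mk, smul_eq_mul, mul_one, smul_zero,
      map_zero, one_smul, add_zero, Prod.mk_add_mk, zero_add, Prod.mk_eq_zero] at hx
    simp [hx.1, hx.2]
end

section
/- Let k be a field of characteristic 0, V a finite dimensional k-vector space, and b : V × V → V an antisymmetric bilinear map (b(w,v) = −b(v,w) for all v,w). Let P ⊆ F²(T) be the k-linear span of the elements v⊗w − w⊗v − b(v,w) for v, w ∈ V. Then the condition (J): (F¹(T)·P·F¹(T)) ∩ F²(T) = P holds if and only if b satisfies the Jacobi identity: b(u, b(v,w)) + b(v, b(w,u)) + b(w, b(u,v)) = 0 for all u, v, w ∈ V, i.e., if and only if (V, b) is a Lie algebra. -/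
/-- The degree-one component `T¹ = V` of the tensor algebra. -/
noncomputable def TM14 (k : Type*) [Field k] (V : Type*) [AddCommGroup V] [Module k V] :
    Submodule k (TensorAlgebra k V) :=
  LinearMap.range (TensorAlgebra.ι k : V →ₗ[k] TensorAlgebra k V)

/-- The filtered component `F¹(T) = T⁰ ⊕ T¹` of the tensor algebra. -/
noncomputable def TF14_1 (k : Type*) [Field k] (V : Type*) [AddCommGroup V] [Module k V] :
    Submodule k (TensorAlgebra k V) :=
  1 ⊔ TM14 k V

/-- The filtered component `F²(T) = T⁰ ⊕ T¹ ⊕ T²` of the tensor algebra. -/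
noncomputable def TF14_2 (k : Type*) [Field k] (V : Type*) [AddCommGroup V] [Module k V] :
    Submodule k (TensorAlgebra k V) :=
  1 ⊔ TM14 k V ⊔ TM14 k V * TM14 k V

/-- The span `P` of the elements `v⊗w − w⊗v − b(v,w)` inside `F²(T)`. -/
noncomputable def Pspan14 (k : Type*) [Field k] (V : Type*) [AddCommGroup V] [Module k V]
    (b : V →ₗ[k] V →ₗ[k] V) : Submodule k (TensorAlgebra k V) :=
  Submodule.span k {x | ∃ v w : V,
    x = TensorAlgebra.ι k v * TensorAlgebra.ι k w
      - TensorAlgebra.ι k w * TensorAlgebra.ι k v - TensorAlgebra.ι k (b v w)}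

namespace TensorAlgebra

open scoped TensorProduct

section

variable (k : Type*) [Field k] (V : Type*) [AddCommGroup V] [Module k V]

/-- The tensors of degree at most four. -/
abbrev Truncation : Type _ :=
  k × V × (V ⊗[k] V) × (V ⊗[k] (V ⊗[k] V)) × (V ⊗[k] (V ⊗[k] (V ⊗[k] V)))

/-- Left multiplication by a vector on tensors of degree at most four, dropping degree five. -/
noncomputable def truncationShift : V →ₗ[k] Module.End k (Truncation k V) :=
  LinearMap.mk₂ k
    (fun v m => (0, m.1 • v, v ⊗ₜ[k] m.2.1, v ⊗ₜ[k] m.2.2.1, v ⊗ₜ[k] m.2.2.2.1))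
    (fun _ _ _ => by simp [TensorProduct.add_tmul])
    (fun c _ _ => by simp [TensorProduct.smul_tmul', smul_comm c])
    (fun _ _ _ => by simp [TensorProduct.tmul_add, add_smul])
    (fun _ _ _ => by simp [mul_smul])

/-- The projection of the tensor algebra onto its components of degree at most four. -/
noncomputable def truncate : TensorAlgebra k V →ₗ[k] Truncation k V :=
  (LinearMap.applyₗ ((1, 0) : Truncation k V)).comp
    (lift k (truncationShift k V)).toLinearMap

variable {k V}
variable (b : V →ₗ[k] V →ₗ[k] V)

/-- The contraction `u ⊗ v ⊗ w ↦ b(u,v) ⊗ w`. -/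
noncomputable def contractLeft : V ⊗[k] (V ⊗[k] V) →ₗ[k] V ⊗[k] V :=
  (TensorProduct.lift b).rTensor V ∘ₗ (TensorProduct.assoc k V V V).symm.toLinearMap

/-- The contraction `u ⊗ v ⊗ w ↦ u ⊗ b(v,w)`. -/
noncomputable def contractRight : V ⊗[k] (V ⊗[k] V) →ₗ[k] V ⊗[k] V :=
  (TensorProduct.lift b).lTensor V

/-- Symmetrization modulo `P` in degree two: `v ⊗ w ↦ (v w + w v + b(v,w)) / 2`. -/
noncomputable def symmetrizeTwo : V ⊗[k] V →ₗ[k] TensorAlgebra k V :=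
  (2⁻¹ : k) • (TensorProduct.lift ((LinearMap.mul k (TensorAlgebra k V)).compl₁₂ (ι k) (ι k))
    + TensorProduct.lift ((LinearMap.mul k (TensorAlgebra k V)).compl₁₂ (ι k) (ι k)) ∘ₗ
        (TensorProduct.comm k V V).toLinearMap
    + ι k ∘ₗ TensorProduct.lift b)

/-- The reduction of a tensor of degree three to degree at most two, obtained by averaging
`x - σ x` over the permutations `σ` of the factors. -/
noncomputable def symmetrizeThree : V ⊗[k] (V ⊗[k] V) →ₗ[k] TensorAlgebra k V :=
  (6⁻¹ : k) • symmetrizeTwo b ∘ₗ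
    ((3 : k) • contractLeft b + (2 : k) • contractRight b
      + (2 : k) • contractRight b ∘ₗ (TensorProduct.leftComm k V V V).toLinearMap
      + contractLeft b ∘ₗ (TensorProduct.comm k V V).toLinearMap.lTensor V
      + (TensorProduct.comm k V V).toLinearMap ∘ₗ contractRight b)

/-- The reduction of a tensor of degree four compatible with `u p z` for `p ∈ P`. -/
noncomputable def symmetrizeFour :
    V ⊗[k] (V ⊗[k] (V ⊗[k] V)) →ₗ[k] TensorAlgebra k V :=
  (2⁻¹ : k) • symmetrizeThree b ∘ₗ (contractLeft b).lTensor V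

/-- The linear endomorphism of the tensor algebra sending tensors of degree at most four
to their symmetrized representatives of degree at most two modulo `F¹ P F¹`. -/
noncomputable def symmetrize : TensorAlgebra k V →ₗ[k] TensorAlgebra k V :=
  ((Algebra.linearMap k (TensorAlgebra k V)).coprod <| (ι k).coprod <|
    (symmetrizeTwo b).coprod <| (symmetrizeThree b).coprod (symmetrizeFour b)) ∘ₗ truncate k V

@[simp]
lemma truncate_one : truncate k V 1 = (1, 0) := by
  simp [truncate]

@[simp]
lemma truncate_ι_mul (v : V) (x : TensorAlgebra k V) :
    truncate k V (ι k v * x) = truncationShift k V v (truncate k V x) := by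
  simp [truncate]

@[simp]
lemma truncate_ι (v : V) : truncate k V (ι k v) = (0, v, 0) := by
  rw [← mul_one (ι k v), truncate_ι_mul, truncate_one]
  simp [truncationShift]

@[simp]
lemma symmetrizeTwo_tmul (v w : V) : symmetrizeTwo b (v ⊗ₜ w) =
    (2⁻¹ : k) • (ι k v * ι k w + ι k w * ι k v + ι k (b v w)) := by
  simp [symmetrizeTwo]

@[simp]
lemma contractLeft_tmul (u v w : V) : contractLeft b (u ⊗ₜ (v ⊗ₜ w)) = b u v ⊗ₜ w := by
  simp [contractLeft]

@[simp]
lemma contractRight_tmul (u v w : V) : contractRight b (u ⊗ₜ (v ⊗ₜ w)) = u ⊗ₜ b v w := by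
  simp [contractRight]

@[simp]
lemma symmetrize_one : symmetrize b 1 = 1 := by
  simp [symmetrize]

@[simp]
lemma symmetrize_ι (v : V) : symmetrize b (ι k v) = ι k v := by
  simp [symmetrize]

@[simp]
lemma symmetrize_ι_mul_ι (v w : V) :
    symmetrize b (ι k v * ι k w) = symmetrizeTwo b (v ⊗ₜ w) := by
  simp [symmetrize, truncationShift]

@[simp]
lemma symmetrize_ι_mul_ι_mul_ι (u v w : V) :
    symmetrize b (ι k u * (ι k v * ι k w)) = symmetrizeThree b (u ⊗ₜ (v ⊗ₜ w)) := by
  simp [symmetrize, truncationShift]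

@[simp]
lemma symmetrize_ι_mul_ι_mul_ι_mul_ι (u v w z : V) :
    symmetrize b (ι k u * (ι k v * (ι k w * ι k z))) =
      (2⁻¹ : k) • symmetrizeThree b (u ⊗ₜ (b v w ⊗ₜ z)) := by
  simp [symmetrize, truncationShift, symmetrizeFour]

variable {b}

lemma TF14_1_eq_span : TF14_1 k V = Submodule.span k (insert 1 (Set.range (ι k))) := by
  rw [Submodule.span_insert, ← Submodule.one_eq_span, TF14_1, TM14, ← LinearMap.coe_range,
    Submodule.span_eq]

lemma ι_mem_TF14_2 (v : V) : ι k v ∈ TF14_2 k V :=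
  (le_sup_right.trans le_sup_left : TM14 k V ≤ TF14_2 k V) ⟨v, rfl⟩

lemma ι_mul_ι_mem_TF14_2 (v w : V) : ι k v * ι k w ∈ TF14_2 k V :=
  (le_sup_right : TM14 k V * TM14 k V ≤ TF14_2 k V)
    (Submodule.mul_mem_mul ⟨v, rfl⟩ ⟨w, rfl⟩)

lemma relation_mem_Pspan14 (v w : V) :
    ι k v * ι k w - ι k w * ι k v - ι k (b v w) ∈ Pspan14 k V b :=
  Submodule.subset_span ⟨v, w, rfl⟩

variable [CharZero k]

lemma symmetrizeThree_sub_swap_left (hanti : ∀ v w : V, b w v = - b v w)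
    (u v w : V) :
    symmetrizeThree b (u ⊗ₜ (v ⊗ₜ w)) - symmetrizeThree b (v ⊗ₜ (u ⊗ₜ w)) =
      symmetrizeTwo b (b u v ⊗ₜ w) := by
  simp only [symmetrizeThree, LinearMap.smul_apply, LinearMap.comp_apply, LinearMap.add_apply,
    contractLeft_tmul, contractRight_tmul, LinearEquiv.coe_coe, TensorProduct.leftComm_tmul,
    LinearMap.lTensor_tmul, TensorProduct.comm_tmul, map_add, map_smul, symmetrizeTwo_tmul]
  simp only [hanti u v, hanti u (b v w), hanti v (b u w),
    hanti w (b u v), map_neg, LinearMap.neg_apply, mul_neg, neg_mul]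
  module

lemma symmetrizeThree_sub_swap_right (hanti : ∀ v w : V, b w v = - b v w)
    (hJ : ∀ u v w : V, b u (b v w) + b v (b w u) + b w (b u v) = 0) (u v w : V) :
    symmetrizeThree b (u ⊗ₜ (v ⊗ₜ w)) - symmetrizeThree b (u ⊗ₜ (w ⊗ₜ v)) =
      symmetrizeTwo b (u ⊗ₜ b v w) := by
  have h := congrArg (ι k) (hJ u v w)
  simp only [map_add, map_zero] at h
  simp only [symmetrizeThree, LinearMap.smul_apply, LinearMap.comp_apply, LinearMap.add_apply,
    contractLeft_tmul, contractRight_tmul, LinearEquiv.coe_coe, TensorProduct.leftComm_tmul,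
    LinearMap.lTensor_tmul, TensorProduct.comm_tmul, map_add, map_smul, symmetrizeTwo_tmul]
  simp only [hanti u w, hanti v w, hanti u (b v w), hanti v (b u w),
    hanti w (b u v), map_neg, LinearMap.neg_apply, mul_neg, neg_mul] at h ⊢
  linear_combination (norm := module) (-(1 / 3) : k) • h

lemma symmetrize_relation (hanti : ∀ v w : V, b w v = - b v w) (v w : V) :
    symmetrize b (ι k v * ι k w - ι k w * ι k v - ι k (b v w)) = 0 := by
  simp only [map_sub, symmetrize_ι_mul_ι, symmetrizeTwo_tmul, symmetrize_ι, hanti v w, map_neg]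
  module

lemma symmetrize_ι_mul_relation (hanti : ∀ v w : V, b w v = - b v w)
    (hJ : ∀ u v w : V, b u (b v w) + b v (b w u) + b w (b u v) = 0) (u v w : V) :
    symmetrize b (ι k u * (ι k v * ι k w - ι k w * ι k v - ι k (b v w))) = 0 := by
  simp only [mul_sub, map_sub, symmetrize_ι_mul_ι_mul_ι, symmetrize_ι_mul_ι,
    symmetrizeThree_sub_swap_right hanti hJ, sub_self]

lemma symmetrize_relation_mul_ι (hanti : ∀ v w : V, b w v = - b v w) (v w z : V) :
    symmetrize b ((ι k v * ι k w - ι k w * ι k v - ι k (b v w)) * ι k z) = 0 := by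
  simp only [sub_mul, mul_assoc, map_sub, symmetrize_ι_mul_ι_mul_ι, symmetrize_ι_mul_ι,
    symmetrizeThree_sub_swap_left hanti, sub_self]

lemma symmetrize_ι_mul_relation_mul_ι (hanti : ∀ v w : V, b w v = - b v w) (u v w z : V) :
    symmetrize b (ι k u * (ι k v * ι k w - ι k w * ι k v - ι k (b v w)) * ι k z) = 0 := by
  simp only [mul_sub, sub_mul, mul_assoc, map_sub, symmetrize_ι_mul_ι_mul_ι_mul_ι,
    symmetrize_ι_mul_ι_mul_ι, hanti v w, TensorProduct.neg_tmul, TensorProduct.tmul_neg, map_neg]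
  module

lemma Pspan14_le_ker_symmetrize (hanti : ∀ v w : V, b w v = - b v w) :
    Pspan14 k V b ≤ LinearMap.ker (symmetrize b) := by
  rw [Pspan14, Submodule.span_le]
  rintro _ ⟨v, w, rfl⟩
  exact symmetrize_relation hanti v w

lemma mul_Pspan14_mul_le_ker_symmetrize (hanti : ∀ v w : V, b w v = - b v w)
    (hJ : ∀ u v w : V, b u (b v w) + b v (b w u) + b w (b u v) = 0) :
    TF14_1 k V * Pspan14 k V b * TF14_1 k V ≤ LinearMap.ker (symmetrize b) := by
  rw [TF14_1_eq_span, Pspan14, Submodule.span_mul_span, Submodule.span_mul_span,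
    Submodule.span_le]
  rintro _ ⟨_, ⟨_, hx, _, ⟨v, w, rfl⟩, rfl⟩, _, hy, rfl⟩
  rcases hx with rfl | ⟨u, rfl⟩ <;> rcases hy with rfl | ⟨z, rfl⟩ <;>
    simp only [one_mul, mul_one, SetLike.mem_coe, LinearMap.mem_ker]
  · exact symmetrize_relation hanti v w
  · exact symmetrize_relation_mul_ι hanti v w z
  · exact symmetrize_ι_mul_relation hanti hJ u v w
  · exact symmetrize_ι_mul_relation_mul_ι hanti u v w z

lemma sub_symmetrize_mem_Pspan14 {x : TensorAlgebra k V} (hx : x ∈ TF14_2 k V) :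
    x - symmetrize b x ∈ Pspan14 k V b := by
  suffices TF14_2 k V ≤ (Pspan14 k V b).comap (LinearMap.id - symmetrize b) from this hx
  refine sup_le (sup_le ?_ ?_) ?_
  · rw [Submodule.one_eq_span, Submodule.span_singleton_le_iff_mem]
    simp
  · rintro _ ⟨v, rfl⟩
    simp
  · rw [Submodule.mul_le]
    rintro _ ⟨v, rfl⟩ _ ⟨w, rfl⟩
    rw [Submodule.mem_comap]
    convert (Pspan14 k V b).smul_mem (2⁻¹ : k) (relation_mem_Pspan14 v w) using 1
    simp only [LinearMap.sub_apply, LinearMap.id_apply, symmetrize_ι_mul_ι, symmetrizeTwo_tmul]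
    module

end

section

variable {k : Type*} [Field k] {V : Type*} [AddCommGroup V] [Module k V]
  (b : V →ₗ[k] V →ₗ[k] V)

lemma Pspan14_le_mul_Pspan14_mul :
    Pspan14 k V b ≤ TF14_1 k V * Pspan14 k V b * TF14_1 k V := by
  intro p hp
  have h1 : (1 : TensorAlgebra k V) ∈ TF14_1 k V :=
    Submodule.one_le.1 le_sup_left
  simpa using Submodule.mul_mem_mul (Submodule.mul_mem_mul h1 hp) h1

lemma Pspan14_le_TF14_2 : Pspan14 k V b ≤ TF14_2 k V := by
  rw [Pspan14, Submodule.span_le]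
  rintro _ ⟨v, w, rfl⟩
  exact sub_mem (sub_mem (ι_mul_ι_mem_TF14_2 v w) (ι_mul_ι_mem_TF14_2 w v)) (ι_mem_TF14_2 _)

/-- The cyclic sum of the commutators `u p(v,w) - p(v,w) u`: its cubic terms cancel. -/
lemma cyclic_sum_mem_mul_Pspan14_mul (u v w : V) :
    ι k (b v w) * ι k u - ι k u * ι k (b v w) + (ι k (b w u) * ι k v - ι k v * ι k (b w u))
      + (ι k (b u v) * ι k w - ι k w * ι k (b u v)) ∈
        TF14_1 k V * Pspan14 k V b * TF14_1 k V := by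
  have h1 : (1 : TensorAlgebra k V) ∈ TF14_1 k V :=
    Submodule.one_le.1 le_sup_left
  have hι (x : V) : ι k x ∈ TF14_1 k V := (le_sup_right : TM14 k V ≤ TF14_1 k V) ⟨x, rfl⟩
  have key (x y z : V) :
      ι k x * (ι k y * ι k z - ι k z * ι k y - ι k (b y z)) -
        (ι k y * ι k z - ι k z * ι k y - ι k (b y z)) * ι k x ∈
          TF14_1 k V * Pspan14 k V b * TF14_1 k V := by
    have hp := relation_mem_Pspan14 (b := b) y z
    refine sub_mem ?_ ?_
    · simpa using Submodule.mul_mem_mul (Submodule.mul_mem_mul (hι x) hp) h1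
    · simpa using Submodule.mul_mem_mul (Submodule.mul_mem_mul h1 hp) (hι x)
  convert add_mem (add_mem (key u v w) (key v w u)) (key w u v) using 1
  noncomm_ring

end

end TensorAlgebra

/-- **Condition (J) and the Jacobi identity.** Over a field of characteristic 0, for an
antisymmetric bilinear map `b` and `P` the span of the elements `v⊗w − w⊗v − b(v,w)`,
condition (J): `(F¹(T)·P·F¹(T)) ∩ F²(T) = P` holds if and only if `b` satisfies the Jacobi
identity (i.e. if and only if `(V,b)` is a Lie algebra). -/
theorem stmt14 (k : Type*) [Field k] [CharZero k]
    (V : Type*) [AddCommGroup V] [Module k V] [FiniteDimensional k V]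
    (b : V →ₗ[k] V →ₗ[k] V) (hanti : ∀ v w : V, b w v = - b v w) :
    TF14_1 k V * Pspan14 k V b * TF14_1 k V ⊓ TF14_2 k V = Pspan14 k V b ↔
      ∀ u v w : V, b u (b v w) + b v (b w u) + b w (b u v) = 0 := by
  open TensorAlgebra in
  constructor
  · intro h u v w
    have hmem : ι k (b v w) * ι k u - ι k u * ι k (b v w)
        + (ι k (b w u) * ι k v - ι k v * ι k (b w u))
        + (ι k (b u v) * ι k w - ι k w * ι k (b u v)) ∈ Pspan14 k V b := by
      rw [← h]
      refine ⟨cyclic_sum_mem_mul_Pspan14_mul b u v w, ?_⟩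
      have hcomm (x y : V) : ι k x * ι k y - ι k y * ι k x ∈ TF14_2 k V :=
        sub_mem (ι_mul_ι_mem_TF14_2 x y) (ι_mul_ι_mem_TF14_2 y x)
      exact add_mem (add_mem (hcomm _ _) (hcomm _ _)) (hcomm _ _)
    have h0 := Pspan14_le_ker_symmetrize hanti hmem
    simp only [LinearMap.mem_ker, map_add, map_sub, symmetrize_ι_mul_ι, symmetrizeTwo_tmul,
      hanti u (b v w), hanti v (b w u), hanti w (b u v)] at h0
    apply (ι_leftInverse (R := k)).injective
    simp only [map_add, map_neg, map_zero] at h0 ⊢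
    linear_combination (norm := module) (-1 : k) • h0
  · intro hJ
    refine le_antisymm ?_ (le_inf (Pspan14_le_mul_Pspan14_mul b) (Pspan14_le_TF14_2 b))
    rintro x ⟨hx, hx2⟩
    have h0 : symmetrize b x = 0 := mul_Pspan14_mul_le_ker_symmetrize hanti hJ hx
    simpa [h0] using sub_symmetrize_mem_Pspan14 (b := b) hx2
end

section
/- Let k be a field, V a finite dimensional k-vector space, P ⊆ F²(T) a subspace, I = (P) the two-sided ideal it generates, and R = π_2(P) ⊆ V⊗V the image of P under the projection F²(T) → T² along T^0 ⊕ T^1. Suppose the two-sided ideal of T generated by {LH(f) : 0 ≠ f ∈ I} coincides with the two-sided ideal generated by R (equivalently, T/(P) is a PBW deformation of T/(R)). Then (I): P ∩ F¹(T) = 0, and (J): (F¹(T)·P·F¹(T)) ∩ F²(T) = P. -/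
noncomputable section

variable (k : Type*) [Field k] (V : Type*) [AddCommGroup V] [Module k V]

/-- The degree-one component `T¹ = V` of the tensor algebra. -/
def M16 : Submodule k (TensorAlgebra k V) :=
  LinearMap.range (TensorAlgebra.ι k : V →ₗ[k] TensorAlgebra k V)

/-- The filtered component `F¹(T) = T⁰ ⊕ T¹`. -/
def F16_1 : Submodule k (TensorAlgebra k V) := 1 ⊔ M16 k V

/-- The filtered component `F²(T) = T⁰ ⊕ T¹ ⊕ T²`. -/
def F16_2 : Submodule k (TensorAlgebra k V) := 1 ⊔ M16 k V ⊔ M16 k V * M16 k V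

/-- The degree-`n` projection `T(V) → T(V)` given by the grading of the tensor algebra. -/
def proj16 (n : ℕ) : TensorAlgebra k V →ₗ[k] TensorAlgebra k V :=
  GradedAlgebra.proj
    ((LinearMap.range (TensorAlgebra.ι k : V →ₗ[k] TensorAlgebra k V) ^ ·) :
      ℕ → Submodule k (TensorAlgebra k V)) n

/-- `IsLH f x` says `x` is the leading homogeneous component `LH(f)` of `f` with respect to
the grading of the tensor algebra: `x` is the (nonzero) homogeneous component of `f` of
some degree `n`, and all components of `f` of degree `> n` vanish. -/
def IsLH (f x : TensorAlgebra k V) : Prop :=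
  x ≠ 0 ∧ ∃ n : ℕ, proj16 k V n f = x ∧ ∀ m : ℕ, n < m → proj16 k V m f = 0

/-- The set `{LH(f) : 0 ≠ f ∈ S}` of leading homogeneous components of the nonzero elements
of `S`. -/
def LHset (S : Set (TensorAlgebra k V)) : Set (TensorAlgebra k V) :=
  {x | ∃ f ∈ S, IsLH k V f x}

/-- The two-sided ideal of the `k`-algebra `A` generated by a set `S` (over a field, the
`k`-linear span of all `a·s·b` with `s ∈ S`). -/
def TSI16 {A : Type*} [Ring A] [Algebra k A] (S : Set A) : Submodule k A :=
  Submodule.span k {x | ∃ a s b, s ∈ S ∧ x = a * s * b}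

/-- The projection of `P ⊆ F²(T)` onto the degree-2 component `T² = V⊗V` along `T⁰ ⊕ T¹`. -/
def R16 (P : Submodule k (TensorAlgebra k V)) : Submodule k (TensorAlgebra k V) :=
  Submodule.map (proj16 k V 2) P

section ProjLemmas

variable {k : Type*} [Field k] {V : Type*} [AddCommGroup V] [Module k V]

instance gradedAlgebraM16 : GradedAlgebra (fun n : ℕ => M16 k V ^ n) :=
  TensorAlgebra.gradedAlgebra

theorem proj16_of_mem {i n : ℕ} {x : TensorAlgebra k V} (hx : x ∈ M16 k V ^ i) :
    proj16 k V n x = if i = n then x else 0 := by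
  have h := DirectSum.decompose_of_mem (fun n : ℕ => M16 k V ^ n) hx
  change ((DirectSum.decompose (fun n : ℕ => M16 k V ^ n) x n : ↥(M16 k V ^ n)) :
    TensorAlgebra k V) = _
  rw [h]
  split_ifs with hin
  · subst hin
    simp
  · rw [DirectSum.of_eq_of_ne _ _ _ (Ne.symm hin)]
    rfl

theorem proj16_mem (n : ℕ) (x : TensorAlgebra k V) : proj16 k V n x ∈ M16 k V ^ n :=
  (DirectSum.decompose (fun n : ℕ => M16 k V ^ n) x n).2

theorem proj16_proj16 (n : ℕ) (x : TensorAlgebra k V) :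
    proj16 k V n (proj16 k V n x) = proj16 k V n x := by
  rw [proj16_of_mem (proj16_mem n x), if_pos rfl]

theorem eq_zero_of_proj16_eq_zero {x : TensorAlgebra k V} (h : ∀ n, proj16 k V n x = 0) :
    x = 0 := by
  classical
  rw [← DirectSum.sum_support_decompose (fun n : ℕ => M16 k V ^ n) x]
  exact Finset.sum_eq_zero fun n _ => h n

theorem ι_mem_M16_pow_one (v : V) : TensorAlgebra.ι k v ∈ M16 k V ^ 1 := by
  rw [pow_one]
  exact ⟨v, rfl⟩

theorem proj16_succ_ι_mul (v : V) (x : TensorAlgebra k V) (n : ℕ) :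
    proj16 k V (n + 1) (TensorAlgebra.ι k v * x) = TensorAlgebra.ι k v * proj16 k V n x := by
  rw [add_comm]
  exact DirectSum.coe_decompose_mul_add_of_left_mem (fun n : ℕ => M16 k V ^ n)
    (ι_mem_M16_pow_one v)

theorem proj16_succ_mul_ι (v : V) (x : TensorAlgebra k V) (n : ℕ) :
    proj16 k V (n + 1) (x * TensorAlgebra.ι k v) = proj16 k V n x * TensorAlgebra.ι k v :=
  DirectSum.coe_decompose_mul_add_of_right_mem (fun n : ℕ => M16 k V ^ n)
    (ι_mem_M16_pow_one v)

theorem proj16_zero_ι_mul (v : V) (x : TensorAlgebra k V) :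
    proj16 k V 0 (TensorAlgebra.ι k v * x) = 0 :=
  DirectSum.coe_decompose_mul_of_left_mem_of_not_le (fun n : ℕ => M16 k V ^ n)
    (ι_mem_M16_pow_one v) (by simp)

theorem proj16_zero_mul_ι (v : V) (x : TensorAlgebra k V) :
    proj16 k V 0 (x * TensorAlgebra.ι k v) = 0 :=
  DirectSum.coe_decompose_mul_of_right_mem_of_not_le (fun n : ℕ => M16 k V ^ n)
    (ι_mem_M16_pow_one v) (by simp)

variable (k V) in
/-- The elements without components in degrees `0` and `1` whose degree-`2` component
lies in `R`. -/
def lowDegreeIn (R : Submodule k (TensorAlgebra k V)) : Submodule k (TensorAlgebra k V) :=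
  LinearMap.ker (proj16 k V 0) ⊓ LinearMap.ker (proj16 k V 1) ⊓ R.comap (proj16 k V 2)

theorem mem_lowDegreeIn {R : Submodule k (TensorAlgebra k V)} {x : TensorAlgebra k V} :
    x ∈ lowDegreeIn k V R ↔
      (proj16 k V 0 x = 0 ∧ proj16 k V 1 x = 0) ∧ proj16 k V 2 x ∈ R := by
  simp [lowDegreeIn]

theorem mul_mem_lowDegreeIn_left {R : Submodule k (TensorAlgebra k V)}
    (a : TensorAlgebra k V) :
    ∀ x ∈ lowDegreeIn k V R, a * x ∈ lowDegreeIn k V R := by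
  induction a using TensorAlgebra.induction with
  | algebraMap r =>
    intro x hx
    rw [← Algebra.smul_def]
    exact Submodule.smul_mem _ r hx
  | ι v =>
    intro x hx
    obtain ⟨⟨h0, h1⟩, -⟩ := mem_lowDegreeIn.1 hx
    refine mem_lowDegreeIn.2 ⟨⟨proj16_zero_ι_mul v x, ?_⟩, ?_⟩
    · rw [proj16_succ_ι_mul v x 0, h0, mul_zero]
    · rw [proj16_succ_ι_mul v x 1, h1, mul_zero]
      exact zero_mem _
  | mul a b ha hb =>
    intro x hx
    rw [mul_assoc]
    exact ha _ (hb _ hx)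
  | add a b ha hb =>
    intro x hx
    rw [add_mul]
    exact add_mem (ha _ hx) (hb _ hx)

theorem mul_mem_lowDegreeIn_right {R : Submodule k (TensorAlgebra k V)}
    (a : TensorAlgebra k V) :
    ∀ x ∈ lowDegreeIn k V R, x * a ∈ lowDegreeIn k V R := by
  induction a using TensorAlgebra.induction with
  | algebraMap r =>
    intro x hx
    rw [← Algebra.commutes, ← Algebra.smul_def]
    exact Submodule.smul_mem _ r hx
  | ι v =>
    intro x hx
    obtain ⟨⟨h0, h1⟩, -⟩ := mem_lowDegreeIn.1 hx
    refine mem_lowDegreeIn.2 ⟨⟨proj16_zero_mul_ι v x, ?_⟩, ?_⟩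
    · rw [proj16_succ_mul_ι v x 0, h0, zero_mul]
    · rw [proj16_succ_mul_ι v x 1, h1, zero_mul]
      exact zero_mem _
  | mul a b ha hb =>
    intro x hx
    rw [← mul_assoc]
    exact hb _ (ha _ hx)
  | add a b ha hb =>
    intro x hx
    rw [mul_add]
    exact add_mem (ha _ hx) (hb _ hx)

theorem TSI16_R16_le (P : Submodule k (TensorAlgebra k V)) :
    TSI16 k (R16 k V P : Set (TensorAlgebra k V)) ≤ lowDegreeIn k V (R16 k V P) := by
  refine Submodule.span_le.2 ?_
  rintro _ ⟨a, s, b, hs, rfl⟩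
  refine mul_mem_lowDegreeIn_right b _ (mul_mem_lowDegreeIn_left a _ (mem_lowDegreeIn.2 ?_))
  have hs2 : s ∈ M16 k V ^ 2 := by
    obtain ⟨p, -, rfl⟩ := hs
    exact proj16_mem 2 p
  refine ⟨⟨?_, ?_⟩, ?_⟩
  · rw [proj16_of_mem hs2, if_neg (by decide)]
  · rw [proj16_of_mem hs2, if_neg (by decide)]
  · rw [proj16_of_mem hs2, if_pos rfl]
    exact hs

theorem subset_TSI16 {A : Type*} [Ring A] [Algebra k A] (S : Set A) :
    S ⊆ TSI16 k S := fun s hs =>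
  Submodule.subset_span ⟨1, s, 1, hs, by simp⟩

/-- The leading component of an element of `S` of degree at most `n` lies in the ideal
generated by `LHset k V S`. -/
theorem proj16_mem_TSI16_LHset {S : Set (TensorAlgebra k V)} {f : TensorAlgebra k V}
    (hf : f ∈ S) {n : ℕ} (h : ∀ m, n < m → proj16 k V m f = 0) :
    proj16 k V n f ∈ TSI16 k (LHset k V S) := by
  by_cases h0 : proj16 k V n f = 0
  · rw [h0]
    exact zero_mem _
  · exact subset_TSI16 _ ⟨f, hf, h0, n, rfl, h⟩

theorem one_le_ker_proj16 {n : ℕ} (hn : 0 < n) :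
    (1 : Submodule k (TensorAlgebra k V)) ≤ LinearMap.ker (proj16 k V n) := fun x hx => by
  rw [LinearMap.mem_ker, proj16_of_mem (i := 0) (by simpa using hx), if_neg hn.ne]

theorem M16_le_ker_proj16 {n : ℕ} (hn : 1 < n) :
    M16 k V ≤ LinearMap.ker (proj16 k V n) := fun x hx => by
  rw [LinearMap.mem_ker, proj16_of_mem (i := 1) (by simpa using hx), if_neg hn.ne]

theorem F16_1_le_ker_proj16 {n : ℕ} (hn : 1 < n) :
    F16_1 k V ≤ LinearMap.ker (proj16 k V n) :=
  sup_le (one_le_ker_proj16 (by omega)) (M16_le_ker_proj16 hn)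

theorem F16_2_le_ker_proj16 {n : ℕ} (hn : 2 < n) :
    F16_2 k V ≤ LinearMap.ker (proj16 k V n) := by
  refine sup_le (F16_1_le_ker_proj16 (by omega)) fun x hx => ?_
  rw [LinearMap.mem_ker, proj16_of_mem (i := 2) (by rwa [pow_two]), if_neg hn.ne]

end ProjLemmas

/-- **Necessity of the Braverman–Gaitsgory conditions.** Let `P ⊆ F²(T)` be a subspace,
`I = (P)` and `R = π₂(P)`. If the two-sided ideal generated by the leading homogeneous
components of the nonzero elements of `I` coincides with the two-sided ideal generated by
`R` (i.e. `T/(P)` is a PBW deformation of `T/(R)`), then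
(I): `P ∩ F¹(T) = 0`, and (J): `(F¹(T)·P·F¹(T)) ∩ F²(T) = P`. -/
theorem stmt16 [FiniteDimensional k V] (P : Submodule k (TensorAlgebra k V))
    (hP : P ≤ F16_2 k V)
    (hPBW : TSI16 k (LHset k V (TSI16 k (P : Set (TensorAlgebra k V)) : Set (TensorAlgebra k V)))
      = TSI16 k (R16 k V P : Set (TensorAlgebra k V))) :
    P ⊓ F16_1 k V = ⊥ ∧ F16_1 k V * P * F16_1 k V ⊓ F16_2 k V = P := by
  set I := TSI16 k (P : Set (TensorAlgebra k V)) with hI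
  have hPI : P ≤ I := subset_TSI16 _
  have hlead : ∀ f ∈ I, ∀ n, (∀ m, n < m → proj16 k V m f = 0) →
      proj16 k V n f ∈ lowDegreeIn k V (R16 k V P) := fun f hf n h =>
    TSI16_R16_le P (hPBW ▸ proj16_mem_TSI16_LHset hf h)
  have hlow : ∀ f ∈ I, (∀ m, 1 < m → proj16 k V m f = 0) → f = 0 := by
    intro f hf h
    have h1 : proj16 k V 1 f = 0 := by
      rw [← proj16_proj16]
      exact (mem_lowDegreeIn.1 (hlead f hf 1 h)).1.2
    have hpos : ∀ m, 0 < m → proj16 k V m f = 0 := fun m hm => by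
      obtain rfl | hm := (Nat.succ_le_of_lt hm).eq_or_lt
      exacts [h1, h m hm]
    have h0 : proj16 k V 0 f = 0 := by
      rw [← proj16_proj16]
      exact (mem_lowDegreeIn.1 (hlead f hf 0 hpos)).1.1
    refine eq_zero_of_proj16_eq_zero fun n => ?_
    obtain rfl | hn := n.eq_zero_or_pos
    exacts [h0, hpos n hn]
  refine ⟨?_, le_antisymm ?_ (le_inf ?_ hP)⟩
  · rw [eq_bot_iff]
    rintro f ⟨hfP, hf1⟩
    exact hlow f (hPI hfP) fun m hm => F16_1_le_ker_proj16 hm hf1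
  · rintro f ⟨hf, hf2⟩
    have hfI : f ∈ I := by
      have hle : F16_1 k V * P * F16_1 k V ≤ I := by
        refine Submodule.mul_le.2 fun y hy b _ => ?_
        induction hy using Submodule.mul_induction_on' with
        | mem_mul_mem a _ p hp => exact Submodule.subset_span ⟨a, p, b, hp, rfl⟩
        | add x _ y _ hx hy =>
          rw [add_mul]
          exact add_mem hx hy
      exact hle hf
    have hR : proj16 k V 2 f ∈ R16 k V P := by
      rw [← proj16_proj16]
      exact (mem_lowDegreeIn.1
        (hlead f hfI 2 fun m hm => F16_2_le_ker_proj16 hm hf2)).2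
    obtain ⟨p, hp, hpf⟩ := hR
    have hfp : f - p = 0 := by
      refine hlow _ (sub_mem hfI (hPI hp)) fun m hm => ?_
      obtain rfl | hm := (Nat.succ_le_of_lt hm).eq_or_lt
      · rw [map_sub, hpf, sub_self]
      · exact F16_2_le_ker_proj16 hm (sub_mem hf2 (hP hp))
    rw [sub_eq_zero.1 hfp]
    exact hp
  · have h1 : (1 : Submodule k (TensorAlgebra k V)) ≤ F16_1 k V := le_sup_left
    calc P = 1 * P * 1 := by rw [one_mul, mul_one]
      _ ≤ F16_1 k V * P * F16_1 k V := by gcongr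
end
end

section
/- Let k be a field, V a finite dimensional k-vector space, and R ⊆ V⊗V the k-linear span of all elements v⊗w − w⊗v for v, w ∈ V, so that T/(R) is the symmetric algebra S(V). Let α : R → V and β : R → k be linear maps and set P = {r − α(r) − β(r) : r ∈ R} and I = (P). Then the two-sided ideal of T generated by {LH(f) : 0 ≠ f ∈ I} coincides with the ideal (R) (i.e., T/(P) is a PBW deformation of S(V)) if and only if the following three conditions hold on W = (R⊗V) ∩ (V⊗R): (i) (α⊗id − id⊗α)(W) ⊆ R; (ii) for all x ∈ W, α((α⊗id − id⊗α)(x)) = −(β⊗id − id⊗β)(x); (iii) for all x ∈ W, β((α⊗id − id⊗α)(x)) = 0. -/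
open scoped TensorProduct

noncomputable section

variable (k : Type*) [Field k] (V : Type*) [AddCommGroup V] [Module k V]

/-- The multiplication map `V ⊗ V → T(V)`, `v ⊗ w ↦ ι(v)·ι(w)`, identifying `V ⊗ V` with the
degree-2 component `T²` of the tensor algebra. -/
def mul17 : V ⊗[k] V →ₗ[k] TensorAlgebra k V :=
  LinearMap.mul' k (TensorAlgebra k V) ∘ₗ
    TensorProduct.map (TensorAlgebra.ι k) (TensorAlgebra.ι k)

/-- The degree-`n` projection `T(V) → T(V)` given by the grading of the tensor algebra. -/
def proj17 (n : ℕ) : TensorAlgebra k V →ₗ[k] TensorAlgebra k V :=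
  GradedAlgebra.proj
    ((LinearMap.range (TensorAlgebra.ι k : V →ₗ[k] TensorAlgebra k V) ^ ·) :
      ℕ → Submodule k (TensorAlgebra k V)) n

/-- `IsLH17 f x` says `x` is the leading homogeneous component `LH(f)` of `f`. -/
def IsLH17 (f x : TensorAlgebra k V) : Prop :=
  x ≠ 0 ∧ ∃ n : ℕ, proj17 k V n f = x ∧ ∀ m : ℕ, n < m → proj17 k V m f = 0

/-- The set `{LH(f) : 0 ≠ f ∈ S}`. -/
def LHset17 (S : Set (TensorAlgebra k V)) : Set (TensorAlgebra k V) :=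
  {x | ∃ f ∈ S, IsLH17 k V f x}

/-- The two-sided ideal of the `k`-algebra `A` generated by a set `S`. -/
def TSI17 {A : Type*} [Ring A] [Algebra k A] (S : Set A) : Submodule k A :=
  Submodule.span k {x | ∃ a s b, s ∈ S ∧ x = a * s * b}

/-- The subspace `R ⊆ V ⊗ V` spanned by the elements `v⊗w − w⊗v`, so that
`T/(R) = S(V)` is the symmetric algebra. -/
def R17 : Submodule k (V ⊗[k] V) :=
  Submodule.span k {x | ∃ v w : V, x = v ⊗ₜ[k] w - w ⊗ₜ[k] v}

variable (α : R17 k V →ₗ[k] V) (β : R17 k V →ₗ[k] k)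

/-- The map `R → T(V)`, `r ↦ r − α(r) − β(r)`, whose range is the space of relations `P`. -/
def Pmap17 : R17 k V →ₗ[k] TensorAlgebra k V :=
  mul17 k V ∘ₗ (R17 k V).subtype - TensorAlgebra.ι k ∘ₗ α
    - Algebra.linearMap k (TensorAlgebra k V) ∘ₗ β

/-- The space of relations `P = {r − α(r) − β(r) : r ∈ R}`. -/
def Psub17 : Submodule k (TensorAlgebra k V) := LinearMap.range (Pmap17 k V α β)

/-- The inclusion `R ⊗ V → V⊗V⊗V`. -/
def j171 : (↥(R17 k V)) ⊗[k] V →ₗ[k] (V ⊗[k] V) ⊗[k] V :=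
  TensorProduct.map (R17 k V).subtype LinearMap.id

/-- The inclusion `V ⊗ R → V⊗V⊗V`. -/
def j172 : V ⊗[k] (↥(R17 k V)) →ₗ[k] (V ⊗[k] V) ⊗[k] V :=
  (TensorProduct.assoc k V V V).symm.toLinearMap ∘ₗ
    TensorProduct.map LinearMap.id (R17 k V).subtype

/-- `α ⊗ id : R ⊗ V → V ⊗ V`. -/
def aid17 : (↥(R17 k V)) ⊗[k] V →ₗ[k] V ⊗[k] V := TensorProduct.map α LinearMap.id

/-- `id ⊗ α : V ⊗ R → V ⊗ V`. -/
def ida17 : V ⊗[k] (↥(R17 k V)) →ₗ[k] V ⊗[k] V := TensorProduct.map LinearMap.id α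

/-- `β ⊗ id : R ⊗ V → V`. -/
def bid17 : (↥(R17 k V)) ⊗[k] V →ₗ[k] V :=
  (TensorProduct.lid k V).toLinearMap ∘ₗ TensorProduct.map β LinearMap.id

/-- `id ⊗ β : V ⊗ R → V`. -/
def idb17 : V ⊗[k] (↥(R17 k V)) →ₗ[k] V :=
  (TensorProduct.rid k V).toLinearMap ∘ₗ TensorProduct.map LinearMap.id β

namespace PBW17

open MvPolynomial Module

section Filtration

variable {k ι : Type*} [Field k]

/-- The polynomials of total degree `< d`. -/
def degLT (k ι : Type*) [Field k] (d : ℕ) : Submodule k (MvPolynomial ι k) :=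
  Submodule.span k ((fun m : ι →₀ ℕ => monomial m (1 : k)) '' {m | m.degree < d})

lemma monomial_mem_degLT {m : ι →₀ ℕ} {d : ℕ} (h : m.degree < d) :
    monomial m (1 : k) ∈ degLT k ι d :=
  Submodule.subset_span ⟨m, h, rfl⟩

lemma degLT_le {d : ℕ} {N : Submodule k (MvPolynomial ι k)}
    (h : ∀ m : ι →₀ ℕ, m.degree < d → monomial m (1 : k) ∈ N) : degLT k ι d ≤ N :=
  Submodule.span_le.2 (by rintro _ ⟨m, hm, rfl⟩; exact h m hm)

lemma degLT_mono {d e : ℕ} (h : d ≤ e) : degLT k ι d ≤ degLT k ι e :=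
  degLT_le fun _ hm => monomial_mem_degLT (hm.trans_le h)

lemma degLT_zero : degLT k ι 0 = ⊥ := by
  simp [degLT]

lemma exists_mem_degLT (p : MvPolynomial ι k) : ∃ d, p ∈ degLT k ι d := by
  induction p using MvPolynomial.induction_on' with
  | monomial m a =>
    refine ⟨m.degree + 1, ?_⟩
    have := (degLT k ι (m.degree + 1)).smul_mem a (monomial_mem_degLT (Nat.lt_succ_self _))
    simpa [smul_monomial] using this
  | add p q hp hq =>
    obtain ⟨d, hd⟩ := hp
    obtain ⟨e, he⟩ := hq
    exact ⟨max d e, add_mem (degLT_mono (le_max_left _ _) hd) (degLT_mono (le_max_right _ _) he)⟩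

lemma nonempty_of_exists {s : Finset ι} {p : ι → Prop} (h : ∃ j ∈ s, p j) : s.Nonempty :=
  h.imp fun _ hj => hj.1

lemma degree_single_add (j : ι) (m : ι →₀ ℕ) :
    (Finsupp.single j 1 + m).degree = m.degree + 1 := by
  rw [map_add, Finsupp.degree_single, add_comm]

lemma X_mul_monomial (j : ι) (m : ι →₀ ℕ) :
    X j * monomial m (1 : k) = monomial (Finsupp.single j 1 + m) 1 := by
  rw [X, monomial_mul, one_mul]

lemma constr_monomial {M : Type*} [AddCommGroup M] [Module k M] (f : (ι →₀ ℕ) → M) (m : ι →₀ ℕ) :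
    (basisMonomials ι k).constr k f (monomial m 1) = f m := by
  rw [← (basisMonomials ι k).constr_basis k f m, coe_basisMonomials]

lemma X_mul_mem_degLT (i : ι) {d : ℕ} {p : MvPolynomial ι k} (hp : p ∈ degLT k ι d) :
    X i * p ∈ degLT k ι (d + 1) := by
  have : degLT k ι d ≤ (degLT k ι (d + 1)).comap (LinearMap.mulLeft k (X i)) := by
    refine degLT_le fun m hm => ?_
    rw [Submodule.mem_comap, LinearMap.mulLeft_apply, X_mul_monomial]
    exact monomial_mem_degLT (by simpa [degree_single_add] using hm)
  exact this hp

lemma eq_zero_of_isHomogeneous_of_mem_degLT {p : MvPolynomial ι k} {n : ℕ}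
    (hp : p.IsHomogeneous n) (h : p ∈ degLT k ι n) : p = 0 := by
  have hle : degLT k ι n ≤ LinearMap.ker (homogeneousComponent (R := k) (σ := ι) n) := by
    refine degLT_le fun m hm => ?_
    rw [LinearMap.mem_ker, homogeneousComponent_of_mem (isHomogeneous_monomial 1 rfl), if_neg]
    exact hm.ne'
  have := hle h
  rwa [LinearMap.mem_ker, homogeneousComponent_of_mem hp, if_pos rfl] at this

variable {V : Type*} [AddCommGroup V] [Module k V]

/-- A basis of `V` turns vectors into linear forms. -/
def linForm (b : Basis ι k V) : V →ₗ[k] MvPolynomial ι k := b.constr k X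

@[simp] lemma linForm_basis (b : Basis ι k V) (i : ι) : linForm b (b i) = X i :=
  b.constr_basis k _ i

lemma linForm_mul_mem_degLT (b : Basis ι k V) (v : V) {d : ℕ} {p : MvPolynomial ι k}
    (hp : p ∈ degLT k ι d) : linForm b v * p ∈ degLT k ι (d + 1) := by
  have : (⊤ : Submodule k V) ≤ (degLT k ι (d + 1)).comap
      (LinearMap.mulRight k p ∘ₗ linForm b) := by
    rw [← b.span_eq, Submodule.span_le]
    rintro _ ⟨i, rfl⟩
    simpa using X_mul_mem_degLT i hp
  exact this Submodule.mem_top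

end Filtration

section Action

variable {k ι V : Type*} [Field k] [LinearOrder ι] [AddCommGroup V] [Module k V]
  (b : Basis ι k V) (br : V →ₗ[k] V →ₗ[k] V) (bt : V →ₗ[k] V →ₗ[k] k)

/-- Approximations to the action of `V` on polynomials: `actApprox d` is the correct action on
polynomials of degree `< d`. -/
def actApprox : ℕ → V →ₗ[k] MvPolynomial ι k →ₗ[k] MvPolynomial ι k
  | 0 => 0
  | d + 1 => b.constr k fun i => (basisMonomials ι k).constr k fun m =>
      if m.degree < d then actApprox d (b i) (monomial m 1)
      else if h : ∃ j ∈ m.support, j < i then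
        let j := m.support.min' (nonempty_of_exists h)
        let q := monomial (m - Finsupp.single j 1) (1 : k)
        X i * monomial m 1 + actApprox d (b j) (actApprox d (b i) q - X i * q)
          + actApprox d (br (b i) (b j)) q + bt (b i) (b j) • q
      else X i * monomial m 1

/-- The action of `V` on polynomials. -/
def act : V →ₗ[k] MvPolynomial ι k →ₗ[k] MvPolynomial ι k :=
  ((basisMonomials ι k).constr k (M' := MvPolynomial ι k)).toLinearMap ∘ₗ
    LinearMap.pi fun m => (LinearMap.applyₗ (monomial m (1 : k))) ∘ₗ
      actApprox b br bt (m.degree + 1)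

lemma actApprox_succ_monomial (d : ℕ) (i : ι) (m : ι →₀ ℕ) (hm : m.degree < d) :
    actApprox b br bt (d + 1) (b i) (monomial m 1) = actApprox b br bt d (b i) (monomial m 1) := by
  rw [actApprox, Basis.constr_basis, constr_monomial, if_pos hm]

lemma actApprox_succ {d : ℕ} {p : MvPolynomial ι k} (hp : p ∈ degLT k ι d) (v : V) :
    actApprox b br bt (d + 1) v p = actApprox b br bt d v p := by
  have : degLT k ι d ≤ LinearMap.eqLocus (actApprox b br bt (d + 1) v) (actApprox b br bt d v) := by
    refine degLT_le fun m hm => ?_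
    have : (actApprox b br bt (d + 1)).flip (monomial m 1) =
        (actApprox b br bt d).flip (monomial m 1) :=
      b.ext fun i => actApprox_succ_monomial b br bt d i m hm
    exact LinearMap.congr_fun this v
  exact this hp

lemma actApprox_of_le {d e : ℕ} (h : d ≤ e) {p : MvPolynomial ι k} (hp : p ∈ degLT k ι d) (v : V) :
    actApprox b br bt e v p = actApprox b br bt d v p := by
  induction e, h using Nat.le_induction with
  | base => rfl
  | succ e h ih => rw [actApprox_succ b br bt (degLT_mono h hp), ih]

lemma act_monomial (v : V) (m : ι →₀ ℕ) :
    act b br bt v (monomial m 1) = actApprox b br bt (m.degree + 1) v (monomial m 1) := by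
  simp only [act, LinearMap.comp_apply, LinearEquiv.coe_coe]
  rw [constr_monomial]
  simp

lemma act_eq {d : ℕ} {p : MvPolynomial ι k} (hp : p ∈ degLT k ι d) (v : V) :
    act b br bt v p = actApprox b br bt d v p := by
  have : degLT k ι d ≤ LinearMap.eqLocus (act b br bt v) (actApprox b br bt d v) := by
    refine degLT_le fun m hm => ?_
    rw [LinearMap.mem_eqLocus, act_monomial]
    exact (actApprox_of_le b br bt (Nat.succ_le_of_lt hm)
      (monomial_mem_degLT (Nat.lt_succ_self _)) v).symm
  exact this hp

lemma act_monomial_of_le {i : ι} {m : ι →₀ ℕ} (h : ∀ j ∈ m.support, i ≤ j) :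
    act b br bt (b i) (monomial m 1) = X i * monomial m 1 := by
  rw [act_monomial, actApprox, Basis.constr_basis, constr_monomial,
    if_neg (lt_irrefl _), dif_neg]
  simpa using h

lemma actApprox_sub_mem (d : ℕ) : ∀ e ≤ d, ∀ p ∈ degLT k ι e, ∀ v,
    actApprox b br bt d v p - linForm b v * p ∈ degLT k ι e := by
  induction d with
  | zero =>
    intro e he p hp v
    obtain rfl : e = 0 := by omega
    rw [degLT_zero, Submodule.mem_bot] at hp ⊢
    simp [hp]
  | succ d ih =>
    have key : ∀ m : ι →₀ ℕ, m.degree < d + 1 → ∀ i,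
        actApprox b br bt (d + 1) (b i) (monomial m 1) - X i * monomial m 1
          ∈ degLT k ι (m.degree + 1) := by
      intro m hm i
      by_cases hd : m.degree < d
      · rw [actApprox_succ_monomial b br bt d i m hd]
        simpa using ih _ hd _ (monomial_mem_degLT (Nat.lt_succ_self _)) (b i)
      rw [actApprox, Basis.constr_basis, constr_monomial,
        if_neg hd]
      split_ifs with h
      · have hne : m.support.Nonempty := nonempty_of_exists h
        set j := m.support.min' hne
        set q := m - Finsupp.single j 1
        have hj : j ∈ m.support := Finset.min'_mem _ _
        have hq : Finsupp.single j 1 + q = m := by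
          apply add_tsub_cancel_of_le
          rw [Finsupp.single_le_iff]
          exact Nat.one_le_iff_ne_zero.2 (Finsupp.mem_support_iff.1 hj)
        have hdeg := degree_single_add j q
        rw [hq] at hdeg
        have hqm : monomial q (1 : k) ∈ degLT k ι d := monomial_mem_degLT (by omega)
        have mem : ∀ (v : V) (p : MvPolynomial ι k), p ∈ degLT k ι d →
            actApprox b br bt d v p ∈ degLT k ι (d + 1) := fun v p hp => by
          have := add_mem (degLT_mono (Nat.le_succ d) (ih d le_rfl p hp v))
            (linForm_mul_mem_degLT b v hp)
          simpa using this
        have h1 := ih d le_rfl _ hqm (b i)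
        rw [linForm_basis] at h1
        have hd' : m.degree = d := by omega
        rw [hd', add_assoc, add_assoc, add_sub_cancel_left]
        exact add_mem (mem _ _ h1) (add_mem (mem _ _ hqm)
          (Submodule.smul_mem _ _ (degLT_mono (Nat.le_succ d) hqm)))
      · simp
    intro e he p hp v
    have : degLT k ι e ≤ (degLT k ι e).comap
        (actApprox b br bt (d + 1) v - LinearMap.mulLeft k (linForm b v)) := by
      refine degLT_le fun m hm => ?_
      have : (⊤ : Submodule k V) ≤ (degLT k ι e).comap
          ((actApprox b br bt (d + 1)).flip (monomial m 1) -
            LinearMap.mulRight k (monomial m 1) ∘ₗ linForm b) := by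
        rw [← b.span_eq, Submodule.span_le]
        rintro _ ⟨i, rfl⟩
        simpa using degLT_mono hm (key m (hm.trans_le he) i)
      exact this Submodule.mem_top
    exact this hp

lemma act_sub_mem {d : ℕ} {p : MvPolynomial ι k} (hp : p ∈ degLT k ι d) (v : V) :
    act b br bt v p - linForm b v * p ∈ degLT k ι d := by
  rw [act_eq b br bt hp]
  exact actApprox_sub_mem b br bt d d le_rfl p hp v

lemma act_X_mul {i j : ι} (hij : j < i) {m : ι →₀ ℕ} (h : ∀ l ∈ m.support, j ≤ l) :
    act b br bt (b i) (X j * monomial m 1) =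
      act b br bt (b j) (act b br bt (b i) (monomial m 1))
        + act b br bt (br (b i) (b j)) (monomial m 1) + bt (b i) (b j) • monomial m 1 := by
  have hsupp : ∀ l ∈ (Finsupp.single j 1 + m).support, j ≤ l := by
    intro l hl
    rcases Finset.mem_union.1 (Finsupp.support_add hl) with hl | hl
    · exact (Finset.mem_singleton.1 (Finsupp.support_single_subset hl)).ge
    · exact h l hl
  have hj : j ∈ (Finsupp.single j 1 + m).support := by simp
  have hex : ∃ l ∈ (Finsupp.single j 1 + m).support, l < i := ⟨j, hj, hij⟩
  have hmin : (Finsupp.single j 1 + m).support.min' ⟨j, hj⟩ = j :=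
    le_antisymm (Finset.min'_le _ _ hj) (Finset.le_min' _ _ _ hsupp)
  have hm : monomial m (1 : k) ∈ degLT k ι (m.degree + 1) :=
    monomial_mem_degLT (Nat.lt_succ_self _)
  rw [X_mul_monomial, act_monomial, degree_single_add, actApprox, Basis.constr_basis,
    constr_monomial, degree_single_add, if_neg (lt_irrefl _), dif_pos hex]
  simp only [hmin, add_tsub_cancel_left]
  have h1 := act_sub_mem b br bt hm (b i)
  rw [linForm_basis] at h1
  rw [← act_eq b br bt hm, ← act_eq b br bt hm, ← act_eq b br bt h1, map_sub, X_mul_monomial i m,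
    act_monomial_of_le b br bt (i := j), X_mul_monomial, X_mul_monomial, ← add_assoc, ← add_assoc,
    add_comm (Finsupp.single i 1)]
  · abel
  · intro l hl
    rcases Finset.mem_union.1 (Finsupp.support_add hl) with hl | hl
    · exact hij.le.trans (Finset.mem_singleton.1 (Finsupp.support_single_subset hl)).ge
    · exact h l hl

/-- The failure of `act` to satisfy `[v, w] = br v w + bt v w`. -/
def defect : V →ₗ[k] V →ₗ[k] MvPolynomial ι k →ₗ[k] MvPolynomial ι k :=
  LinearMap.mk₂ k (fun v w => act b br bt v ∘ₗ act b br bt w - act b br bt w ∘ₗ act b br bt v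
      - act b br bt (br v w) - bt v w • LinearMap.id)
    (fun v v' w => by
      simp only [map_add, LinearMap.add_apply, LinearMap.add_comp, LinearMap.comp_add]; module)
    (fun c v w => by
      simp only [map_smul, LinearMap.smul_apply, LinearMap.smul_comp, LinearMap.comp_smul,
        smul_eq_mul]; module)
    (fun v w w' => by
      simp only [map_add, LinearMap.add_comp, LinearMap.comp_add]; module)
    (fun c v w => by
      simp only [map_smul, LinearMap.smul_comp, LinearMap.comp_smul, smul_eq_mul]; module)

lemma defect_apply (v w : V) (p : MvPolynomial ι k) :
    defect b br bt v w p = act b br bt v (act b br bt w p) - act b br bt w (act b br bt v p)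
      - act b br bt (br v w) p - bt v w • p := rfl

variable {br bt}

lemma defect_of_le {i j : ι} (hij : j < i) {m : ι →₀ ℕ} (h : ∀ l ∈ m.support, j ≤ l) :
    defect b br bt (b i) (b j) (monomial m 1) = 0 := by
  rw [defect_apply, act_monomial_of_le b br bt h, act_X_mul b br bt hij h]
  abel

lemma defect_self (hbr : br.IsAlt) (hbt : bt.IsAlt) (v : V) (p : MvPolynomial ι k) :
    defect b br bt v v p = 0 := by
  simp [defect_apply, hbr v, hbt v]

lemma defect_neg (hbr : br.IsAlt) (hbt : bt.IsAlt) (v w : V) (p : MvPolynomial ι k) :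
    -defect b br bt v w p = defect b br bt w v p := by
  simp only [defect_apply, ← hbr.neg w v, ← hbt.neg w v, map_neg, LinearMap.neg_apply]
  module

/-- The inductive step of the Poincaré–Birkhoff–Witt argument: the Jacobi and cocycle identities
propagate the vanishing of the defect. -/
lemma defect_act (hbr : br.IsAlt) (hbt : bt.IsAlt)
    (jac : ∀ u v w, br (br u v) w + br (br v w) u + br (br w u) v = 0)
    (coc : ∀ u v w, bt (br u v) w + bt (br v w) u + bt (br w u) v = 0)
    {q : MvPolynomial ι k} (hq : ∀ v w, defect b br bt v w q = 0) {u v w : V}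
    (hu : defect b br bt u w (act b br bt v q) = 0)
    (hv : defect b br bt v w (act b br bt u q) = 0) :
    defect b br bt u v (act b br bt w q) = 0 := by
  have h1 := congrArg (act b br bt u) (hq v w)
  have h2 := congrArg (act b br bt v) (hq u w)
  have h3 := congrArg (act b br bt w) (hq u v)
  have h4 := hq (br u w) v
  have h5 := hq u (br v w)
  have h6 := hq w (br u v)
  have hj : br (br u w) v + br u (br v w) + br w (br u v) = 0 := by
    rw [← hbr.neg (br v w) u, ← hbr.neg (br u v) w, ← hbr.neg w u, map_neg, LinearMap.neg_apply,
      ← neg_zero, ← jac u v w]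
    abel
  have hc : bt (br u w) v + bt u (br v w) + bt w (br u v) = 0 := by
    rw [← hbt.neg (br v w) u, ← hbt.neg (br u v) w, ← hbr.neg w u, map_neg, LinearMap.neg_apply,
      ← neg_zero, ← coc u v w]
    abel
  have hj' := congrArg (fun x => act b br bt x q) hj
  have hc' := congrArg (fun c => c • q) hc
  simp only [defect_apply, map_sub, map_add, map_smul, map_zero, LinearMap.add_apply,
    LinearMap.zero_apply, zero_smul, add_smul] at *
  linear_combination (exp := 1) h1 - h2 + h3 + h4 + h5 + h6 + hu - hv + hj' + hc'

lemma defect_eq_zero (hbr : br.IsAlt) (hbt : bt.IsAlt)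
    (jac : ∀ u v w, br (br u v) w + br (br v w) u + br (br w u) v = 0)
    (coc : ∀ u v w, bt (br u v) w + bt (br v w) u + bt (br w u) v = 0)
    (p : MvPolynomial ι k) (v w : V) : defect b br bt v w p = 0 := by
  suffices ∀ d, ∀ p ∈ degLT k ι d, ∀ v w, defect b br bt v w p = 0 by
    obtain ⟨d, hd⟩ := exists_mem_degLT p
    exact this d p hd v w
  intro d
  induction d with
  | zero =>
    intro p hp v w
    rw [degLT_zero, Submodule.mem_bot] at hp
    rw [hp, map_zero]
  | succ d ih =>
    have min_case : ∀ (m : ι →₀ ℕ) (i j : ι), (∀ l ∈ m.support, j ≤ l) →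
        defect b br bt (b i) (b j) (monomial m 1) = 0 := by
      intro m i j h
      rcases lt_trichotomy i j with hij | rfl | hij
      · rw [← neg_eq_zero, defect_neg b hbr hbt]
        exact defect_of_le b hij fun l hl => hij.le.trans (h l hl)
      · exact defect_self b hbr hbt _ _
      · exact defect_of_le b hij h
    have key : ∀ m : ι →₀ ℕ, m.degree < d + 1 → ∀ i j,
        defect b br bt (b i) (b j) (monomial m 1) = 0 := by
      intro m hm i j
      by_cases hj : ∀ l ∈ m.support, j ≤ l
      · exact min_case m i j hj
      by_cases hi : ∀ l ∈ m.support, i ≤ l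
      · rw [← neg_eq_zero, defect_neg b hbr hbt]
        exact min_case m j i hi
      push Not at hi hj
      have hne := nonempty_of_exists hj
      set l := m.support.min' hne
      have hl : l ∈ m.support := Finset.min'_mem _ _
      set q := m - Finsupp.single l 1
      have hq : Finsupp.single l 1 + q = m := by
        apply add_tsub_cancel_of_le
        rw [Finsupp.single_le_iff]
        exact Nat.one_le_iff_ne_zero.2 (Finsupp.mem_support_iff.1 hl)
      have hmin : ∀ x ∈ m.support, l ≤ x := fun x hx => Finset.min'_le _ _ hx
      have hmin' : ∀ x, (∃ y ∈ m.support, y < x) → l < x := fun x ⟨y, hy, hyx⟩ =>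
        (hmin y hy).trans_lt hyx
      have hqmin : ∀ x ∈ q.support, l ≤ x := fun x hx =>
        hmin x (Finsupp.support_mono tsub_le_self hx)
      have hdeg := degree_single_add l q
      rw [hq] at hdeg
      have hqm : monomial q (1 : k) ∈ degLT k ι d := monomial_mem_degLT (by omega)
      have comm : ∀ i j, l < j →
          defect b br bt (b i) (b l) (act b br bt (b j) (monomial q 1)) = 0 := by
        intro i j hlj
        have h1 := ih _ (act_sub_mem b br bt hqm (b j)) (b i) (b l)
        rw [map_sub, linForm_basis, sub_eq_zero] at h1
        rw [h1, X_mul_monomial]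
        refine min_case _ i l fun x hx => ?_
        rcases Finset.mem_union.1 (Finsupp.support_add hx) with hx | hx
        · exact hlj.le.trans (Finset.mem_singleton.1 (Finsupp.support_single_subset hx)).ge
        · exact hqmin x hx
      rw [← hq, ← X_mul_monomial, ← act_monomial_of_le b br bt hqmin]
      exact defect_act b hbr hbt jac coc (ih _ hqm) 
        (comm i j (hmin' _ hj)) (comm j i (hmin' _ hi))
    intro p hp v w
    have : degLT k ι (d + 1) ≤ LinearMap.ker (defect b br bt v w) := by
      refine degLT_le fun m hm => ?_
      have : (defect b br bt).compr₂ (LinearMap.applyₗ (monomial m 1)) = 0 :=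
        LinearMap.ext_basis b b fun i j => by simpa using key m hm i j
      exact LinearMap.congr_fun₂ this v w
    exact this hp

end Action

section TwoSidedIdeals

variable {k A : Type*} [Field k] [Ring A] [Algebra k A] {S : Set A}

lemma subset_TSI17 : S ⊆ TSI17 k S := fun s hs =>
  Submodule.subset_span ⟨1, s, 1, hs, by simp⟩

lemma mul_mem_TSI17 {x : A} (hx : x ∈ TSI17 k S) (a c : A) : a * x * c ∈ TSI17 k S := by
  have : TSI17 k S ≤ (TSI17 k S).comap (LinearMap.mulRight k c ∘ₗ LinearMap.mulLeft k a) := by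
    refine Submodule.span_le.2 ?_
    rintro _ ⟨a', s, c', hs, rfl⟩
    exact Submodule.subset_span ⟨a * a', s, c' * c, hs, by simp [mul_assoc]⟩
  exact this hx

lemma mul_mem_TSI17_left {x : A} (hx : x ∈ TSI17 k S) (a : A) : a * x ∈ TSI17 k S := by
  simpa using mul_mem_TSI17 hx a 1

lemma mul_mem_TSI17_right {x : A} (hx : x ∈ TSI17 k S) (c : A) : x * c ∈ TSI17 k S := by
  simpa using mul_mem_TSI17 hx 1 c

lemma TSI17_le_TSI17 {S' : Set A} (h : S ⊆ TSI17 k S') : TSI17 k S ≤ TSI17 k S' := by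
  refine Submodule.span_le.2 ?_
  rintro _ ⟨a, s, c, hs, rfl⟩
  exact mul_mem_TSI17 (h hs) a c

lemma map_eq_zero_of_mem_TSI17 {B : Type*} [Ring B] [Algebra k B] (φ : A →ₐ[k] B)
    (h : ∀ s ∈ S, φ s = 0) {x : A} (hx : x ∈ TSI17 k S) : φ x = 0 := by
  have : TSI17 k S ≤ LinearMap.ker φ.toLinearMap := by
    refine Submodule.span_le.2 ?_
    rintro _ ⟨a, s, c, hs, rfl⟩
    simp [h s hs]
  exact this hx

end TwoSidedIdeals

section TensorAlgebra

variable {k ι V : Type*} [Field k] [AddCommGroup V] [Module k V] (b : Basis ι k V)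

/-- The quotient map from the tensor algebra to the polynomial ring. -/
def toPoly : TensorAlgebra k V →ₐ[k] MvPolynomial ι k := TensorAlgebra.lift k (linForm b)

@[simp] lemma toPoly_ι (v : V) : toPoly b (TensorAlgebra.ι k v) = linForm b v :=
  TensorAlgebra.lift_ι_apply _ _

@[simp] lemma mul17_tmul (v w : V) :
    mul17 k V (v ⊗ₜ w) = TensorAlgebra.ι k v * TensorAlgebra.ι k w := rfl

/-- The commutator `v ⊗ w - w ⊗ v` as an element of `R17`. -/
def commR : V →ₗ[k] V →ₗ[k] R17 k V :=
  LinearMap.mk₂ k (fun v w => ⟨v ⊗ₜ[k] w - w ⊗ₜ[k] v, Submodule.subset_span ⟨v, w, rfl⟩⟩)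
    (fun v v' w => Subtype.ext <| by simp [TensorProduct.add_tmul, TensorProduct.tmul_add]; abel)
    (fun c v w => Subtype.ext <| by simp [TensorProduct.smul_tmul', smul_sub])
    (fun v w w' => Subtype.ext <| by simp [TensorProduct.add_tmul, TensorProduct.tmul_add]; abel)
    (fun c v w => Subtype.ext <| by simp [TensorProduct.smul_tmul', smul_sub])

@[simp] lemma coe_commR (v w : V) :
    ((commR v w : R17 k V) : V ⊗[k] V) = v ⊗ₜ[k] w - w ⊗ₜ[k] v := rfl

lemma commR_self (v : V) : commR (k := k) v v = 0 := Subtype.ext (sub_self _)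

lemma span_commR : Submodule.span k {r : R17 k V | ∃ v w, r = commR v w} = ⊤ := by
  apply Submodule.map_injective_of_injective (R17 k V).injective_subtype
  rw [Submodule.map_span, Submodule.map_subtype_top]
  change _ = Submodule.span k _
  congr 1
  ext x
  constructor
  · rintro ⟨_, ⟨v, w, rfl⟩, rfl⟩
    exact ⟨v, w, rfl⟩
  · rintro ⟨v, w, rfl⟩
    exact ⟨_, ⟨v, w, rfl⟩, rfl⟩

lemma toPoly_mul17_of_mem {r : V ⊗[k] V} (hr : r ∈ R17 k V) : toPoly b (mul17 k V r) = 0 := by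
  have : R17 k V ≤ LinearMap.ker ((toPoly b).toLinearMap ∘ₗ mul17 k V) := by
    refine Submodule.span_le.2 ?_
    rintro _ ⟨v, w, rfl⟩
    simp [mul_comm]
  exact this hr

lemma mem_R17_of_toPoly_mul17 {r : V ⊗[k] V} (hr : toPoly b (mul17 k V r) = 0) : r ∈ R17 k V := by
  classical
  let g : MvPolynomial ι k →ₗ[k] (V ⊗[k] V) ⧸ R17 k V :=
    (basisMonomials ι k).constr k fun m =>
      if h : ∃ x : ι × ι, m = Finsupp.single x.1 1 + Finsupp.single x.2 1 then
        (R17 k V).mkQ (b h.choose.1 ⊗ₜ b h.choose.2) else 0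
  have hg : g ∘ₗ (toPoly b).toLinearMap ∘ₗ mul17 k V = (R17 k V).mkQ := by
    refine (b.tensorProduct b).ext ?_
    rintro ⟨i, j⟩
    have hex : ∃ x : ι × ι, (Finsupp.single i 1 + Finsupp.single j 1 : ι →₀ ℕ) =
        Finsupp.single x.1 1 + Finsupp.single x.2 1 := ⟨(i, j), rfl⟩
    have hX : (X i * X j : MvPolynomial ι k) =
        monomial (Finsupp.single i 1 + Finsupp.single j 1) 1 := by
      rw [← X_mul_monomial]; rfl
    simp only [Basis.tensorProduct_apply, LinearMap.comp_apply, mul17_tmul,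
      AlgHom.toLinearMap_apply, map_mul, toPoly_ι, linForm_basis, hX, g, constr_monomial]
    rw [dif_pos hex]
    have hc := hex.choose_spec
    rw [Finsupp.single_add_single_eq_single_add_single one_ne_zero one_ne_zero] at hc
    rcases hc with ⟨h1, h2⟩ | ⟨-, h1, h2⟩ | ⟨h0, -, -⟩
    · rw [← h1, ← h2]
    · rw [← h1, ← h2, ← sub_eq_zero, ← map_sub, Submodule.mkQ_apply,
        Submodule.Quotient.mk_eq_zero]
      exact (commR (b j) (b i)).2
    · exact absurd h0 (by decide)
  have := LinearMap.congr_fun hg r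
  rw [LinearMap.comp_apply, LinearMap.comp_apply, AlgHom.toLinearMap_apply, hr, map_zero] at this
  exact (Submodule.Quotient.mk_eq_zero _).1 this.symm

lemma toPoly_eq_zero_iff {x : TensorAlgebra k V} :
    toPoly b x = 0 ↔
      x ∈ TSI17 k (Submodule.map (mul17 k V) (R17 k V) : Set (TensorAlgebra k V)) := by
  refine ⟨fun h => ?_, map_eq_zero_of_mem_TSI17 _ ?_⟩
  · set J := TSI17 k (Submodule.map (mul17 k V) (R17 k V) : Set (TensorAlgebra k V))
    let I : TwoSidedIdeal (TensorAlgebra k V) := TwoSidedIdeal.mk' J J.zero_mem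
      J.add_mem J.neg_mem (fun {x y} hy => mul_mem_TSI17_left hy x)
      (fun {x y} hx => mul_mem_TSI17_right hx y)
    have hI : ∀ y, y ∈ I ↔ y ∈ J := fun y => TwoSidedIdeal.mem_mk' ..
    have hle : TensorAlgebra.symRingCon k V ≤ I.ringCon := by
      refine RingCon.ringConGen_le.2 ?_
      rintro _ _ ⟨v, w⟩
      rw [TwoSidedIdeal.rel_iff, hI]
      exact subset_TSI17 ⟨_, (commR v w).2, by simp⟩
    have hcomp : toPoly b = ((SymmetricAlgebra.equivMvPolynomial b : _ →ₐ[k] _).comp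
        (SymmetricAlgebra.algHom k V)) := by
      refine TensorAlgebra.hom_ext (b.ext fun i => ?_)
      have := SymmetricAlgebra.equivMvPolynomial_ι_apply b i
      rw [LinearMap.comp_apply, AlgHom.toLinearMap_apply, toPoly_ι, linForm_basis]
      exact this.symm
    have h0 : SymmetricAlgebra.algHom k V x = SymmetricAlgebra.algHom k V 0 := by
      apply (SymmetricAlgebra.equivMvPolynomial b).injective
      rw [map_zero, map_zero, ← h, hcomp]
      rfl
    have h1 : I.ringCon x 0 := hle ((RingCon.eq _).1 h0)
    rw [TwoSidedIdeal.rel_iff, sub_zero, hI] at h1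
    exact h1
  · rintro _ ⟨r, hr, rfl⟩
    exact toPoly_mul17_of_mem b hr

lemma toPoly_isHomogeneous {n : ℕ} {x : TensorAlgebra k V}
    (hx : x ∈ LinearMap.range (TensorAlgebra.ι k : V →ₗ[k] TensorAlgebra k V) ^ n) :
    (toPoly b x).IsHomogeneous n := by
  induction hx using Submodule.pow_induction_on_left' with
  | algebraMap r =>
    rw [AlgHom.commutes]
    exact isHomogeneous_C _ _
  | add x y i hx hy ihx ihy =>
    rw [map_add]
    exact ihx.add ihy
  | mem_mul m hm i x hx ih =>
    obtain ⟨v, rfl⟩ := hm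
    rw [map_mul, toPoly_ι, Nat.succ_eq_one_add]
    refine IsHomogeneous.mul ?_ ih
    have : (⊤ : Submodule k V) ≤ (homogeneousSubmodule ι k 1).comap (linForm b) := by
      rw [← b.span_eq, Submodule.span_le]
      rintro _ ⟨i, rfl⟩
      simpa using isHomogeneous_X k i
    exact this Submodule.mem_top

lemma proj17_mem (n : ℕ) (x : TensorAlgebra k V) :
    proj17 k V n x ∈ LinearMap.range (TensorAlgebra.ι k : V →ₗ[k] TensorAlgebra k V) ^ n :=
  SetLike.coe_mem _

lemma proj17_of_mem {i : ℕ} (n : ℕ) {x : TensorAlgebra k V}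
    (hx : x ∈ LinearMap.range (TensorAlgebra.ι k : V →ₗ[k] TensorAlgebra k V) ^ i) :
    proj17 k V n x = if i = n then x else 0 := by
  split_ifs with h
  · subst h
    exact DirectSum.decompose_of_mem_same _ hx
  · exact DirectSum.decompose_of_mem_ne _ hx h

lemma sum_proj17 {n : ℕ} {x : TensorAlgebra k V} (hx : ∀ m, n < m → proj17 k V m x = 0) :
    ∑ i ∈ Finset.range (n + 1), proj17 k V i x = x := by
  classical
  conv_rhs => rw [← DirectSum.sum_support_decompose
    ((LinearMap.range (TensorAlgebra.ι k : V →ₗ[k] TensorAlgebra k V) ^ ·)) x]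
  refine (Finset.sum_subset ?_ ?_).symm
  · intro i hi
    by_contra h
    rw [Finset.mem_range, not_lt] at h
    rw [DFinsupp.mem_support_iff] at hi
    exact hi (Subtype.ext (hx i h))
  · intro i _ hi
    rw [DFinsupp.notMem_support_iff] at hi
    exact congrArg Subtype.val hi

lemma mul17_mem (r : V ⊗[k] V) :
    mul17 k V r ∈ LinearMap.range (TensorAlgebra.ι k : V →ₗ[k] TensorAlgebra k V) ^ 2 := by
  induction r with
  | zero => simp
  | add x y hx hy => rw [map_add]; exact add_mem hx hy
  | tmul v w =>
    rw [mul17_tmul, pow_two]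
    exact Submodule.mul_mem_mul ⟨v, rfl⟩ ⟨w, rfl⟩

lemma ι_mem (v : V) : TensorAlgebra.ι k v ∈
    LinearMap.range (TensorAlgebra.ι k : V →ₗ[k] TensorAlgebra k V) ^ 1 := by
  rw [pow_one]; exact ⟨v, rfl⟩

lemma algebraMap_mem (c : k) : algebraMap k (TensorAlgebra k V) c ∈
    LinearMap.range (TensorAlgebra.ι k : V →ₗ[k] TensorAlgebra k V) ^ 0 := by
  rw [pow_zero]; exact Submodule.algebraMap_mem c

lemma proj17_quadratic (n : ℕ) (r : V ⊗[k] V) (v : V) (c : k) :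
    proj17 k V n (mul17 k V r + TensorAlgebra.ι k v + algebraMap k _ c) =
      (if 2 = n then mul17 k V r else 0) + (if 1 = n then TensorAlgebra.ι k v else 0)
        + if 0 = n then algebraMap k _ c else 0 := by
  rw [map_add, map_add, proj17_of_mem n (mul17_mem r), proj17_of_mem n (ι_mem v),
    proj17_of_mem n (algebraMap_mem c)]

section Deformation

variable (α : R17 k V →ₗ[k] V) (β : R17 k V →ₗ[k] k)

lemma Pmap17_apply (r : R17 k V) : Pmap17 k V α β r =
    mul17 k V r + TensorAlgebra.ι k (-α r) + algebraMap k _ (-β r) := by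
  simp [Pmap17, sub_eq_add_neg]

/-- The ideal of relations of the deformed algebra. -/
abbrev relIdeal : Submodule k (TensorAlgebra k V) :=
  TSI17 k (Psub17 k V α β : Set (TensorAlgebra k V))

lemma Pmap17_mem (r : R17 k V) : Pmap17 k V α β r ∈ relIdeal α β := subset_TSI17 ⟨r, rfl⟩

/-- The deformation is of PBW type iff leading components of relations vanish in the polynomial
ring. -/
lemma TSI17_LHset17_eq_iff :
    TSI17 k (LHset17 k V (relIdeal α β : Set (TensorAlgebra k V))) =
        TSI17 k (Submodule.map (mul17 k V) (R17 k V) : Set (TensorAlgebra k V)) ↔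
      ∀ f ∈ relIdeal α β, ∀ n, (∀ m, n < m → proj17 k V m f = 0) →
        toPoly b (proj17 k V n f) = 0 := by
  constructor
  · intro h f hf n hn
    by_cases h0 : proj17 k V n f = 0
    · rw [h0, map_zero]
    · rw [toPoly_eq_zero_iff, ← h]
      exact subset_TSI17 ⟨f, hf, h0, n, rfl, hn⟩
  · intro h
    apply le_antisymm
    · apply TSI17_le_TSI17
      rintro x ⟨f, hf, -, n, rfl, hn⟩
      exact (toPoly_eq_zero_iff b).1 (h f hf n hn)
    · apply TSI17_le_TSI17
      rintro _ ⟨r, hr, rfl⟩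
      by_cases h0 : mul17 k V r = 0
      · rw [h0]
        exact Submodule.zero_mem _
      · refine subset_TSI17 ⟨_, Pmap17_mem α β ⟨r, hr⟩, h0, 2, ?_, fun m hm => ?_⟩
        · rw [Pmap17_apply, proj17_quadratic]
          simp
        · rw [Pmap17_apply, proj17_quadratic, if_neg (by omega), if_neg (by omega),
            if_neg (by omega), add_zero, add_zero]

/-- The overlap of two relations yields a relation of degree at most two. -/
lemma overlap_mem {y : R17 k V ⊗[k] V} {z : V ⊗[k] R17 k V} (h : j171 k V y = j172 k V z) :
    mul17 k V (aid17 k V α y - ida17 k V α z) +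
      TensorAlgebra.ι k (bid17 k V β y - idb17 k V β z) ∈ relIdeal α β := by
  let M : (V ⊗[k] V) ⊗[k] V →ₗ[k] TensorAlgebra k V :=
    LinearMap.mul' k _ ∘ₗ TensorProduct.map (mul17 k V) (TensorAlgebra.ι k)
  have hM : M ∘ₗ (TensorProduct.assoc k V V V).symm.toLinearMap =
      LinearMap.mul' k _ ∘ₗ TensorProduct.map (TensorAlgebra.ι k) (mul17 k V) := by
    ext u v w
    simp [M, mul_assoc]
  have hy : ∀ y, M (j171 k V y) - mul17 k V (aid17 k V α y) - TensorAlgebra.ι k (bid17 k V β y)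
      ∈ relIdeal α β := by
    intro y
    induction y with
    | zero => simp
    | add x y hx hy =>
      convert add_mem hx hy using 1
      simp only [map_add]
      abel
    | tmul r v =>
      convert mul_mem_TSI17_right (Pmap17_mem α β r) (TensorAlgebra.ι k v) using 1
      simp [M, j171, aid17, bid17, Pmap17, sub_mul, Algebra.smul_def]
  have hz : ∀ z, M (j172 k V z) - mul17 k V (ida17 k V α z) - TensorAlgebra.ι k (idb17 k V β z)
      ∈ relIdeal α β := by
    intro z
    induction z with
    | zero => simp
    | add x y hx hy =>
      convert add_mem hx hy using 1
      simp only [map_add]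
      abel
    | tmul v r =>
      convert mul_mem_TSI17_left (Pmap17_mem α β r) (TensorAlgebra.ι k v) using 1
      have := LinearMap.congr_fun hM (v ⊗ₜ (r : V ⊗[k] V))
      simp only [LinearMap.comp_apply, LinearEquiv.coe_coe, TensorProduct.map_tmul,
        LinearMap.mul'_apply] at this
      simp [j172, ida17, idb17, Pmap17, mul_sub, this, Algebra.smul_def, Algebra.commutes]
  convert sub_mem (hz z) (hy y) using 1
  rw [h]
  simp only [map_sub]
  abel

end Deformation

end TensorAlgebra

section Equivalence

variable {k ι V : Type*} [Field k] [AddCommGroup V] [Module k V] (b : Basis ι k V)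
  (α : R17 k V →ₗ[k] V) (β : R17 k V →ₗ[k] k)

lemma linForm_injective : Function.Injective (linForm b) := by
  have h : linForm b = (Finsupp.linearCombination k X) ∘ₗ b.repr.toLinearMap :=
    b.ext fun i => by simp
  rw [h]
  rw [LinearMap.coe_comp]
  exact Function.Injective.comp (linearIndependent_X ι k) b.repr.injective

lemma eq_zero_of_linear_mem_relIdeal
    (h : ∀ f ∈ relIdeal α β, ∀ n, (∀ m, n < m → proj17 k V m f = 0) →
      toPoly b (proj17 k V n f) = 0) {v : V} {c : k}
    (hf : TensorAlgebra.ι k v + algebraMap k _ c ∈ relIdeal α β) : v = 0 ∧ c = 0 := by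
  have hproj := fun n => proj17_quadratic n (0 : V ⊗[k] V) v c
  simp only [map_zero, zero_add, ite_self] at hproj
  have hv : v = 0 := by
    have := h _ hf 1 fun m hm => by
      rw [hproj, if_neg (by omega), if_neg (by omega), add_zero]
    rw [hproj] at this
    apply linForm_injective b
    simpa using this
  refine ⟨hv, ?_⟩
  have := h _ hf 0 fun m hm => by
    rw [hproj, hv, if_neg (by omega : ¬ 0 = m), map_zero, ite_self, add_zero]
  rw [hproj] at this
  simpa using this

lemma overlap_conditions
    (h : ∀ f ∈ relIdeal α β, ∀ n, (∀ m, n < m → proj17 k V m f = 0) →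
      toPoly b (proj17 k V n f) = 0)
    {y : R17 k V ⊗[k] V} {z : V ⊗[k] R17 k V} (hyz : j171 k V y = j172 k V z) :
    ∃ hm : aid17 k V α y - ida17 k V α z ∈ R17 k V,
      α ⟨aid17 k V α y - ida17 k V α z, hm⟩ = -(bid17 k V β y - idb17 k V β z) ∧
      β ⟨aid17 k V α y - ida17 k V α z, hm⟩ = 0 := by
  have hmem := overlap_mem α β hyz
  have hR : aid17 k V α y - ida17 k V α z ∈ R17 k V := by
    apply mem_R17_of_toPoly_mul17 b
    have hproj := fun n => proj17_quadratic n (aid17 k V α y - ida17 k V α z)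
      (bid17 k V β y - idb17 k V β z) 0
    simp only [map_zero, add_zero, ite_self] at hproj
    have := h _ hmem 2 fun m hm => by
      rw [hproj, if_neg (by omega), if_neg (by omega), add_zero]
    rw [hproj] at this
    simpa using this
  have hlin : TensorAlgebra.ι k (bid17 k V β y - idb17 k V β z + α ⟨_, hR⟩) +
      algebraMap k _ (β ⟨_, hR⟩) ∈ relIdeal α β := by
    convert sub_mem hmem (Pmap17_mem α β ⟨_, hR⟩) using 1
    rw [Pmap17_apply]
    simp only [map_add, map_neg]
    abel
  obtain ⟨h1, h2⟩ := eq_zero_of_linear_mem_relIdeal b α β h hlin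
  exact ⟨hR, eq_neg_of_add_eq_zero_right h1, h2⟩

lemma overlap_commR (u v w : V) :
    j171 k V (commR u v ⊗ₜ w + commR v w ⊗ₜ u + commR w u ⊗ₜ v) =
      j172 k V (u ⊗ₜ commR v w + v ⊗ₜ commR w u + w ⊗ₜ commR u v) := by
  simp only [j171, j172, map_add, TensorProduct.map_tmul, LinearMap.comp_apply,
    Submodule.subtype_apply, coe_commR, LinearMap.id_apply, TensorProduct.sub_tmul,
    TensorProduct.tmul_sub, map_sub, LinearEquiv.coe_coe, TensorProduct.assoc_symm_tmul]
  abel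

lemma overlap_alpha_commR (u v w : V) :
    aid17 k V α (commR u v ⊗ₜ w + commR v w ⊗ₜ u + commR w u ⊗ₜ v) -
        ida17 k V α (u ⊗ₜ commR v w + v ⊗ₜ commR w u + w ⊗ₜ commR u v) =
      (commR (α (commR u v)) w + commR (α (commR v w)) u + commR (α (commR w u)) v : R17 k V) := by
  simp only [aid17, ida17, map_add, TensorProduct.map_tmul, LinearMap.id_apply,
    Submodule.coe_add, coe_commR]
  abel

lemma overlap_beta_commR (u v w : V) :
    bid17 k V β (commR u v ⊗ₜ w + commR v w ⊗ₜ u + commR w u ⊗ₜ v) -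
        idb17 k V β (u ⊗ₜ commR v w + v ⊗ₜ commR w u + w ⊗ₜ commR u v) = 0 := by
  simp only [bid17, idb17, map_add, TensorProduct.map_tmul, LinearMap.id_apply,
    LinearMap.comp_apply, LinearEquiv.coe_coe, TensorProduct.lid_tmul, TensorProduct.rid_tmul]
  abel

/-- A linear representation of the deformed algebra on polynomials deforming multiplication
forces leading components of relations to vanish in the polynomial ring. -/
lemma toPoly_proj17_eq_zero (ρ : V →ₗ[k] Module.End k (MvPolynomial ι k))
    (hρ : ∀ d, ∀ p ∈ degLT k ι d, ∀ v, ρ v p - linForm b v * p ∈ degLT k ι d)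
    {f : TensorAlgebra k V} (hf : TensorAlgebra.lift k ρ f = 0) {n : ℕ}
    (hn : ∀ m, n < m → proj17 k V m f = 0) : toPoly b (proj17 k V n f) = 0 := by
  set σ : TensorAlgebra k V →ₗ[k] MvPolynomial ι k :=
    LinearMap.applyₗ 1 ∘ₗ (TensorAlgebra.lift k ρ).toLinearMap
  have key : ∀ (n : ℕ) (x : TensorAlgebra k V),
      x ∈ LinearMap.range (TensorAlgebra.ι k : V →ₗ[k] TensorAlgebra k V) ^ n →
      σ x ∈ degLT k ι (n + 1) ∧ σ x - toPoly b x ∈ degLT k ι n := by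
    intro n x hx
    induction hx using Submodule.pow_induction_on_left' with
    | algebraMap r =>
      have h1 : σ (algebraMap k _ r) = r • monomial 0 1 := by
        simp [σ, Module.algebraMap_end_apply, smul_eq_C_mul]
      have h2 : toPoly b (algebraMap k _ r) = r • monomial 0 1 := by
        simp [smul_eq_C_mul, algebraMap_eq]
      rw [h1, h2, sub_self]
      exact ⟨Submodule.smul_mem _ _ (monomial_mem_degLT (by simp)), zero_mem _⟩
    | add x y i hx hy ihx ihy =>
      rw [map_add, map_add, add_sub_add_comm]
      exact ⟨add_mem ihx.1 ihy.1, add_mem ihx.2 ihy.2⟩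
    | mem_mul m hm i x hx ih =>
      obtain ⟨v, rfl⟩ := hm
      have h1 : σ (TensorAlgebra.ι k v * x) = ρ v (σ x) := by simp [σ]
      have h2 := hρ _ _ ih.1 v
      rw [h1, map_mul, toPoly_ι]
      constructor
      · simpa using add_mem (degLT_mono (Nat.le_succ _) h2) (linForm_mul_mem_degLT b v ih.1)
      · convert add_mem h2 (linForm_mul_mem_degLT b v ih.2) using 1
        ring
  refine eq_zero_of_isHomogeneous_of_mem_degLT (toPoly_isHomogeneous b (proj17_mem n f)) ?_
  have hsum : σ f = 0 := by simp [σ, hf]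
  rw [← sum_proj17 hn, map_sum, Finset.sum_range_succ] at hsum
  have hlow : ∑ i ∈ Finset.range n, σ (proj17 k V i f) ∈ degLT k ι n :=
    Submodule.sum_mem _ fun i hi =>
      degLT_mono (Finset.mem_range.1 hi) (key i _ (proj17_mem i f)).1
  have := neg_mem (add_mem hlow (key n _ (proj17_mem n f)).2)
  rwa [← add_sub_assoc, hsum, zero_sub, neg_neg] at this

lemma toPoly_proj17_eq_zero_of_jacobi
    (jac : ∀ u v w, α (commR (α (commR u v)) w) + α (commR (α (commR v w)) u)
      + α (commR (α (commR w u)) v) = 0)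
    (coc : ∀ u v w, β (commR (α (commR u v)) w) + β (commR (α (commR v w)) u)
      + β (commR (α (commR w u)) v) = 0)
    {f : TensorAlgebra k V} (hf : f ∈ relIdeal α β) {n : ℕ}
    (hn : ∀ m, n < m → proj17 k V m f = 0) : toPoly b (proj17 k V n f) = 0 := by
  classical
  let : LinearOrder ι := linearOrderOfSTO WellOrderingRel
  set br : V →ₗ[k] V →ₗ[k] V := commR.compr₂ α
  set bt : V →ₗ[k] V →ₗ[k] k := commR.compr₂ β
  have hbr : br.IsAlt := fun v => by simp [br, commR_self]
  have hbt : bt.IsAlt := fun v => by simp [bt, commR_self]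
  refine toPoly_proj17_eq_zero b (act b br bt)
    (fun d p hp v => act_sub_mem b br bt hp v) (map_eq_zero_of_mem_TSI17 _ ?_ hf) hn
  rintro _ ⟨r, rfl⟩
  have hle : (⊤ : Submodule k (R17 k V)) ≤ LinearMap.ker
      ((TensorAlgebra.lift k (act b br bt)).toLinearMap ∘ₗ Pmap17 k V α β) := by
    rw [← span_commR, Submodule.span_le]
    rintro _ ⟨v, w, rfl⟩
    refine LinearMap.ext fun p => ?_
    have := defect_eq_zero b hbr hbt jac coc p v w
    rw [defect_apply] at this
    refine Eq.trans ?_ this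
    simp [Pmap17, Module.algebraMap_end_apply, br, bt]
  exact hle Submodule.mem_top

end Equivalence

end PBW17

/-- **PBW theorem for deformations of the symmetric algebra (Braverman–Gaitsgory /
Polishchuk–Positselski).** Let `R ⊆ V⊗V` be the span of all `v⊗w − w⊗v` (so `T/(R) = S(V)`),
let `α : R → V`, `β : R → k` be linear, `P = {r − α(r) − β(r) : r ∈ R}` and `I = (P)`. Then
the two-sided ideal generated by the leading homogeneous components of the nonzero elements
of `I` coincides with the ideal `(R)` (i.e. `T/(P)` is a PBW deformation of `S(V)`) if and
only if, on `W = (R⊗V) ∩ (V⊗R)` (described via pairs of representatives with equal image in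
`V⊗V⊗V`): (i) `(α⊗id − id⊗α)(W) ⊆ R`; (ii) `α ∘ (α⊗id − id⊗α) = −(β⊗id − id⊗β)` on `W`;
and (iii) `β ∘ (α⊗id − id⊗α) = 0` on `W`. -/
theorem stmt17 [FiniteDimensional k V] :
    TSI17 k (LHset17 k V
        (TSI17 k (Psub17 k V α β : Set (TensorAlgebra k V)) : Set (TensorAlgebra k V)))
      = TSI17 k (Submodule.map (mul17 k V) (R17 k V) : Set (TensorAlgebra k V)) ↔
      ((∀ (y : (↥(R17 k V)) ⊗[k] V) (z : V ⊗[k] (↥(R17 k V))),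
          j171 k V y = j172 k V z → aid17 k V α y - ida17 k V α z ∈ R17 k V) ∧
        (∀ (y : (↥(R17 k V)) ⊗[k] V) (z : V ⊗[k] (↥(R17 k V)))
            (_ : j171 k V y = j172 k V z) (hm : aid17 k V α y - ida17 k V α z ∈ R17 k V),
          α ⟨aid17 k V α y - ida17 k V α z, hm⟩ = -(bid17 k V β y - idb17 k V β z)) ∧
        (∀ (y : (↥(R17 k V)) ⊗[k] V) (z : V ⊗[k] (↥(R17 k V)))
            (_ : j171 k V y = j172 k V z) (hm : aid17 k V α y - ida17 k V α z ∈ R17 k V),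
          β ⟨aid17 k V α y - ida17 k V α z, hm⟩ = 0)) := by
  let b := Module.finBasis k V
  refine (PBW17.TSI17_LHset17_eq_iff b α β).trans ⟨fun h => ?_, fun ⟨h1, h2, h3⟩ => ?_⟩
  · refine ⟨fun y z hyz => ?_, fun y z hyz hm => ?_, fun y z hyz hm => ?_⟩ <;>
      obtain ⟨hm', hα, hβ⟩ := PBW17.overlap_conditions b α β h hyz
    exacts [hm', hα, hβ]
  · intro f hf n hn
    have hm := fun u v w => h1 _ _ (PBW17.overlap_commR (k := k) u v w)
    have heq : ∀ u v w, (⟨_, hm u v w⟩ : R17 k V) = _ :=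
      fun u v w => Subtype.ext (PBW17.overlap_alpha_commR α u v w)
    refine PBW17.toPoly_proj17_eq_zero_of_jacobi b α β (fun u v w => ?_) (fun u v w => ?_) hf hn
    · have := h2 _ _ (PBW17.overlap_commR u v w) (hm u v w)
      rwa [heq, PBW17.overlap_beta_commR, neg_zero, map_add, map_add] at this
    · have := h3 _ _ (PBW17.overlap_commR u v w) (hm u v w)
      rwa [heq, map_add, map_add] at this
end
end
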